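/- (Second-order accuracy of the discrete iterates) Suppose f has all continuous partial derivatives up to second order on D_M, k₀ and k₁ have all continuous partial derivatives up to second order on [0,1]², and φ : [0,1] → [0,1] has continuous derivatives up to second order; suppose also conditions (i), (ii), (iii) of the existence-uniqueness theorem hold. Let ψ_m, u_m, y_m, v_m, z_m be the continuous iterates defined by ψ₀(x) = f(x,0,0,0,0); u_m(x) = ∫₀¹ G(x,t) ψ_m(t) dt, y_m(x) = u_m(φ(x)), v_m(x) = ∫₀¹ k₀(x,t) u_m(t) dt, z_m(x) = ∫₀¹ k₁(x,t) y_m(t) dt; ψ_{m+1}(x) = f(x, u_m(x), y_m(x), v_m(x), z_m(x)). For N ≥ 1, h = 1/N, grid x_i = ih and trapezium weights ρ_j, let Ψ_m, U_m, Y_m, V_m, Z_m be the discrete iterates defined by Ψ₀(x_i) = f(x_i,0,0,0,0); U_m(x_i) = Σ_j h ρ_j G(x_i,x_j) Ψ_m(x_j), Y_m(x_i) = Σ_j h ρ_j G(φ(x_i),x_j) Ψ_m(x_j), V_m(x_i) = Σ_j h ρ_j k₀(x_i,x_j) U_m(x_j), Z_m(x_i) = Σ_j h ρ_j k₁(x_i,x_j)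 Y_m(x_j); Ψ_{m+1}(x_i) = f(x_i, U_m(x_i), Y_m(x_i), V_m(x_i), Z_m(x_i)). Then for every m ≥ 0 there exists a constant C_m (independent of N) such that, with ‖·‖ the maximum over the grid nodes, ‖Ψ_m − ψ_m‖ ≤ C_m h², ‖U_m − u_m‖ ≤ C_m h², ‖Y_m − y_m‖ ≤ C_m h², ‖V_m − v_m‖ ≤ C_m h², and ‖Z_m − z_m‖ ≤ C_m h². -/

import Mathlib

/-- The Green function of `u'''' = 0` on `[0,1]` with boundary conditions
`u(0) = u(1) = u''(0) = u''(1) = 0`. -/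
noncomputable def greenG (x s : ℝ) : ℝ :=
  if s ≤ x then 1 / 6 * s * (x - 1) * (x ^ 2 - x + s ^ 2)
  else 1 / 6 * x * (s - 1) * (s ^ 2 - s + x ^ 2)

/-- `u(x) = ∫₀¹ G(x,s) ψ(s) ds`. -/
noncomputable def solOp (ψ : ℝ → ℝ) (x : ℝ) : ℝ :=
  ∫ s in (0 : ℝ)..1, greenG x s * ψ s

/-- The operator `A`. -/
noncomputable def Aop (f : ℝ → ℝ → ℝ → ℝ → ℝ → ℝ) (k₀ k₁ : ℝ → ℝ → ℝ) (φ : ℝ → ℝ)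
    (ψ : ℝ → ℝ) : ℝ → ℝ := fun x =>
  f x (solOp ψ x) (solOp ψ (φ x))
    (∫ t in (0 : ℝ)..1, k₀ x t * solOp ψ t)
    (∫ t in (0 : ℝ)..1, k₁ x t * solOp ψ (φ t))

/-- The continuous iterates `ψ₀(x) = f(x,0,0,0,0)`, `ψ_{m+1} = A ψ_m`. -/
noncomputable def psiSeq (f : ℝ → ℝ → ℝ → ℝ → ℝ → ℝ) (k₀ k₁ : ℝ → ℝ → ℝ) (φ : ℝ → ℝ) :
    ℕ → ℝ → ℝ
  | 0 => fun x => f x 0 0 0 0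
  | m + 1 => Aop f k₀ k₁ φ (psiSeq f k₀ k₁ φ m)

/-- The domain `D_M`. -/
def DM (M₀ K₀ K₁ M : ℝ) : Set (ℝ × ℝ × ℝ × ℝ × ℝ) :=
  {p | p.1 ∈ Set.Icc (0 : ℝ) 1 ∧ |p.2.1| ≤ M₀ * M ∧ |p.2.2.1| ≤ M₀ * M ∧
    |p.2.2.2.1| ≤ M₀ * K₀ * M ∧ |p.2.2.2.2| ≤ M₀ * K₁ * M}

/-- Trapezium weights: `ρ₀ = ρ_N = 1/2`, `ρ_j = 1` otherwise. -/
noncomputable def trapW (N j : ℕ) : ℝ := if j = 0 ∨ j = N then 1 / 2 else 1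

/-- `U_m(x_i) = Σ_j h ρ_j G(x_i, x_j) Ψ_m(x_j)` with `h = 1/N`, `x_j = j/N`. -/
noncomputable def Udisc (N : ℕ) (Ψ : ℕ → ℝ) (i : ℕ) : ℝ :=
  ∑ j ∈ Finset.range (N + 1),
    (1 / N : ℝ) * trapW N j * greenG ((i : ℝ) / N) ((j : ℝ) / N) * Ψ j

/-- `Y_m(x_i) = Σ_j h ρ_j G(φ(x_i), x_j) Ψ_m(x_j)`. -/
noncomputable def Ydisc (φ : ℝ → ℝ) (N : ℕ) (Ψ : ℕ → ℝ) (i : ℕ) : ℝ :=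
  ∑ j ∈ Finset.range (N + 1),
    (1 / N : ℝ) * trapW N j * greenG (φ ((i : ℝ) / N)) ((j : ℝ) / N) * Ψ j

/-- `Σ_j h ρ_j k(x_i, x_j) W(x_j)`, the trapezium discretization of `∫₀¹ k(x_i,t) W(t) dt`. -/
noncomputable def Kdisc (k : ℝ → ℝ → ℝ) (N : ℕ) (W : ℕ → ℝ) (i : ℕ) : ℝ :=
  ∑ j ∈ Finset.range (N + 1),
    (1 / N : ℝ) * trapW N j * k ((i : ℝ) / N) ((j : ℝ) / N) * W j

/-- The discrete iterates: `Ψ₀(x_i) = f(x_i,0,0,0,0)` and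
`Ψ_{m+1}(x_i) = f(x_i, U_m(x_i), Y_m(x_i), V_m(x_i), Z_m(x_i))`. -/
noncomputable def PsiSeq (f : ℝ → ℝ → ℝ → ℝ → ℝ → ℝ) (k₀ k₁ : ℝ → ℝ → ℝ) (φ : ℝ → ℝ)
    (N : ℕ) : ℕ → ℕ → ℝ
  | 0 => fun i => f ((i : ℝ) / N) 0 0 0 0
  | m + 1 => fun i =>
      f ((i : ℝ) / N) (Udisc N (PsiSeq f k₀ k₁ φ N m) i) (Ydisc φ N (PsiSeq f k₀ k₁ φ N m) i)
        (Kdisc k₀ N (Udisc N (PsiSeq f k₀ k₁ φ N m)) i)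
        (Kdisc k₁ N (Ydisc φ N (PsiSeq f k₀ k₁ φ N m)) i)

noncomputable section
open Set Filter Topology

/-- `g` is bounded and Lipschitz on `S` with second differences of quadratic order, all with the
same constant `C`: a midpoint form of `C^{1,1}` regularity. -/
structure C11On {E F : Type*} [NormedAddCommGroup E] [NormedSpace ℝ E]
    [NormedAddCommGroup F] [NormedSpace ℝ F] (C : ℝ) (S : Set E) (g : E → F) : Prop where
  nonneg : 0 ≤ C
  bound : ∀ x ∈ S, ‖g x‖ ≤ C
  lip : ∀ x ∈ S, ∀ y ∈ S, ‖g x - g y‖ ≤ C * ‖x - y‖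
  second : ∀ x ∈ S, ∀ y ∈ S,
    ‖g x + g y - (2 : ℝ) • g ((2⁻¹ : ℝ) • (x + y))‖ ≤ C * ‖x - y‖ ^ 2

section C11

variable {E F H : Type*} [NormedAddCommGroup E] [NormedSpace ℝ E]
    [NormedAddCommGroup F] [NormedSpace ℝ F] [NormedAddCommGroup H] [NormedSpace ℝ H]

theorem Convex.half_add_mem {S : Set E} (hS : Convex ℝ S) {x y : E} (hx : x ∈ S) (hy : y ∈ S) :
    (2⁻¹ : ℝ) • (x + y) ∈ S := by
  rw [smul_add]
  exact hS hx hy (by norm_num) (by norm_num) (by norm_num)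

theorem C11On.mono_const {C D : ℝ} {S : Set E} {g : E → F} (hg : C11On C S g) (h : C ≤ D) :
    C11On D S g where
  nonneg := hg.nonneg.trans h
  bound x hx := (hg.bound x hx).trans h
  lip x hx y hy := (hg.lip x hx y hy).trans (by gcongr)
  second x hx y hy := (hg.second x hx y hy).trans (by gcongr)

theorem C11On.continuousOn {C : ℝ} {S : Set E} {g : E → F} (hg : C11On C S g) :
    ContinuousOn g S := by
  have : LipschitzOnWith (Real.toNNReal C) g S :=
    LipschitzOnWith.of_dist_le_mul fun x hx y hy => by
      rw [dist_eq_norm, dist_eq_norm, Real.coe_toNNReal _ hg.nonneg]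
      exact hg.lip x hx y hy
  exact this.continuousOn

theorem C11On.comp {C D : ℝ} {S : Set E} {T : Set F} {f : F → H} {g : E → F}
    (hf : C11On C T f) (hg : C11On D S g) (hS : Convex ℝ S) (hT : Convex ℝ T)
    (hST : MapsTo g S T) : C11On (C + C * D + C * D ^ 2) S (fun x => f (g x)) := by
  have hC := hf.nonneg
  have hD := hg.nonneg
  refine ⟨by positivity, fun x hx => ?_, fun x hx y hy => ?_, fun x hx y hy => ?_⟩
  · have : 0 ≤ C * D + C * D ^ 2 := by positivity
    linarith [hf.bound _ (hST hx)]
  · calc ‖f (g x) - f (g y)‖ ≤ C * ‖g x - g y‖ := hf.lip _ (hST hx) _ (hST hy)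
      _ ≤ C * (D * ‖x - y‖) := by gcongr; exact hg.lip x hx y hy
      _ = (C * D) * ‖x - y‖ := by ring
      _ ≤ _ := by
        gcongr
        have : 0 ≤ C * D ^ 2 := by positivity
        linarith
  · set m := (2⁻¹ : ℝ) • (x + y)
    set n := (2⁻¹ : ℝ) • (g x + g y)
    have hm : m ∈ S := hS.half_add_mem hx hy
    have hn : n ∈ T := hT.half_add_mem (hST hx) (hST hy)
    have h1 : ‖f (g x) + f (g y) - (2 : ℝ) • f n‖ ≤ C * (D * ‖x - y‖) ^ 2 :=
      (hf.second _ (hST hx) _ (hST hy)).trans (by gcongr; exact hg.lip x hx y hy)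
    have h2 : ‖(2 : ℝ) • (f n - f (g m))‖ ≤ C * (D * ‖x - y‖ ^ 2) := by
      rw [norm_smul]
      have e : n - g m = (2⁻¹ : ℝ) • (g x + g y - (2 : ℝ) • g m) := by
        simp only [n]; module
      have h3 := hf.lip n hn (g m) (hST hm)
      rw [e, norm_smul] at h3
      have h4 := mul_le_mul_of_nonneg_left (hg.second x hx y hy) hC
      norm_num at h3 ⊢
      change C * ‖g x + g y - (2 : ℝ) • g m‖ ≤ _ at h4
      linarith
    have e : f (g x) + f (g y) - (2 : ℝ) • f (g m)
        = (f (g x) + f (g y) - (2 : ℝ) • f n) + (2 : ℝ) • (f n - f (g m)) := by module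
    rw [e]
    refine (norm_add_le _ _).trans ((add_le_add h1 h2).trans ?_)
    nlinarith [mul_nonneg hC (sq_nonneg ‖x - y‖)]

theorem C11On.prodMk {C D : ℝ} {S : Set E} {f : E → F} {g : E → H}
    (hf : C11On C S f) (hg : C11On D S g) : C11On (max C D) S (fun x => (f x, g x)) := by
  have hf' := hf.mono_const (le_max_left C D)
  have hg' := hg.mono_const (le_max_right C D)
  exact ⟨hf'.nonneg, fun x hx => norm_prod_le_iff.2 ⟨hf'.bound x hx, hg'.bound x hx⟩,
    fun x hx y hy => norm_prod_le_iff.2 ⟨hf'.lip x hx y hy, hg'.lip x hx y hy⟩,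
    fun x hx y hy => norm_prod_le_iff.2 ⟨hf'.second x hx y hy, hg'.second x hx y hy⟩⟩

theorem C11On.const (S : Set E) (c : F) : C11On ‖c‖ S (fun _ => c) := by
  refine ⟨norm_nonneg c, fun x hx => le_rfl, fun x hx y hy => ?_, fun x hx y hy => ?_⟩
  · simp only [sub_self, norm_zero]; positivity
  · rw [show c + c - (2 : ℝ) • c = 0 by module, norm_zero]; positivity

/-- A `C²` function on a convex set locally has second differences of quadratic order. -/
theorem ContDiffWithinAt.exists_second_difference_le {S : Set E} (hS : Convex ℝ S) {g : E → F}
    {a : E} (ha : a ∈ S) (hg : ContDiffWithinAt ℝ 2 g S a) :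
    ∃ C : ℝ, 0 ≤ C ∧ ∃ t ∈ 𝓝[S] a, ∀ x ∈ t, ∀ y ∈ t,
      ‖g x + g y - (2 : ℝ) • g ((2⁻¹ : ℝ) • (x + y))‖ ≤ C * ‖x - y‖ ^ 2 := by
  rw [show (2 : WithTop ℕ∞) = 1 + 1 by norm_num,
    contDiffWithinAt_succ_iff_hasFDerivWithinAt' (by simp)] at hg
  obtain ⟨u, hu, -, -, g', hg', hc⟩ := hg
  rw [insert_eq_of_mem ha] at hu
  obtain ⟨K, v, hv, hK⟩ := hc.exists_lipschitzOnWith hS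
  obtain ⟨ε, hε, hsub⟩ := Metric.mem_nhdsWithin_iff.1 (inter_mem hu hv)
  have hB : Convex ℝ (Metric.ball a ε ∩ S) := (convex_ball a ε).inter hS
  refine ⟨K, K.2, Metric.ball a ε ∩ S,
    inter_mem (mem_nhdsWithin_of_mem_nhds (Metric.ball_mem_nhds a hε)) self_mem_nhdsWithin, ?_⟩
  intro x hx y hy
  set m := (2⁻¹ : ℝ) • (x + y) with hm
  set d := (2⁻¹ : ℝ) • (x - y) with hd
  have hxm : x = m + d := by simp only [hm, hd]; module
  have hym : y = m - d := by simp only [hm, hd]; module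
  have key : ∀ z ∈ Metric.ball a ε ∩ S, ∀ e : E, m + e = z → ∀ t ∈ Icc (0 : ℝ) 1,
      m + t • e ∈ Metric.ball a ε ∩ S := by
    intro z hz e he t ht
    have := hB (hB.half_add_mem hx hy) hz (sub_nonneg.2 ht.2) ht.1 (by ring)
    rw [← he] at this
    convert this using 1
    simp only [← hm]; module
  have k1 := key x hx d hxm.symm
  have k2 := key y hy (-d) (by rw [hym]; module)
  have hder : ∀ z ∈ Metric.ball a ε ∩ S, ∀ e : E, m + e = z → ∀ t ∈ Icc (0 : ℝ) 1,
      HasDerivWithinAt (fun t : ℝ => g (m + t • e)) (g' (m + t • e) e) (Icc 0 1) t := by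
    intro z hz e he t ht
    have h1 := (hg' _ (hsub (key z hz e he t ht)).1)
    have h2 : HasDerivWithinAt (fun t : ℝ => m + t • e) e (Icc 0 1) t := by
      simpa using (((hasDerivAt_id t).smul_const e).const_add m).hasDerivWithinAt
    exact h1.comp_hasDerivWithinAt t h2 fun s hs => (key z hz e he s hs).2
  have h := norm_image_sub_le_of_norm_deriv_le_segment_01' (C := K * ‖x - y‖ ^ 2)
    (fun t ht => (hder x hx d hxm.symm t ht).add (hder y hy (-d) (by rw [hym]; module) t ht)) ?_
  · convert h using 2
    simp only [Pi.add_apply, one_smul, zero_smul, add_zero, ← hxm, ← sub_eq_add_neg, ← hym]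
    module
  · intro t ht
    have ht' := Ico_subset_Icc_self ht
    have hl := hK.dist_le_mul _ (hsub (k1 t ht')).2 _ (hsub (k2 t ht')).2
    rw [dist_eq_norm, dist_eq_norm] at hl
    have e1 : m + t • d - (m + t • -d) = t • (x - y) := by simp only [hd]; module
    rw [e1, norm_smul, Real.norm_of_nonneg ht.1] at hl
    have e2 : g' (m + t • d) d + g' (m + t • -d) (-d) = (g' (m + t • d) - g' (m + t • -d)) d := by
      simp [sub_eq_add_neg]
    rw [e2]
    have e3 : ‖d‖ = 2⁻¹ * ‖x - y‖ := by rw [hd, norm_smul]; norm_num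
    calc _ ≤ ‖g' (m + t • d) - g' (m + t • -d)‖ * ‖d‖ := ContinuousLinearMap.le_opNorm _ _
      _ ≤ (K * (1 * ‖x - y‖)) * (1 * ‖x - y‖) := by
        rw [e3]
        gcongr
        · exact hl.trans (by gcongr; exact ht.2.le)
        · norm_num
      _ = _ := by ring

theorem ContDiffOn.exists_c11On {S : Set E} (hS : Convex ℝ S) (hc : IsCompact S) {g : E → F}
    (hg : ContDiffOn ℝ 2 g S) : ∃ C : ℝ, C11On C S g := by
  obtain ⟨B, hB⟩ := hc.exists_bound_of_continuousOn hg.continuousOn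
  obtain ⟨K, hK⟩ := hg.exists_lipschitzOnWith (by norm_num) hS hc
  have hsec : ∃ C : ℝ, 0 ≤ C ∧ ∀ p ∈ S ×ˢ S, p.1 ∈ S → p.2 ∈ S →
      ‖g p.1 + g p.2 - (2 : ℝ) • g ((2⁻¹ : ℝ) • (p.1 + p.2))‖ ≤ C * ‖p.1 - p.2‖ ^ 2 := by
    refine (hc.prod hc).induction_on (p := fun T => ∃ C : ℝ, 0 ≤ C ∧ ∀ p ∈ T, p.1 ∈ S → p.2 ∈ S →
      ‖g p.1 + g p.2 - (2 : ℝ) • g ((2⁻¹ : ℝ) • (p.1 + p.2))‖ ≤ C * ‖p.1 - p.2‖ ^ 2)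
      ⟨0, le_rfl, by simp⟩ ?_ ?_ ?_
    · rintro s t hst ⟨C, hC0, hC⟩
      exact ⟨C, hC0, fun p hp => hC p (hst hp)⟩
    · rintro s t ⟨C, hC0, hC⟩ ⟨D, hD0, hD⟩
      refine ⟨max C D, le_max_of_le_left hC0, ?_⟩
      rintro p (hp | hp) h1 h2
      · exact (hC p hp h1 h2).trans (by gcongr; exact le_max_left _ _)
      · exact (hD p hp h1 h2).trans (by gcongr; exact le_max_right _ _)
    · rintro ⟨a, b⟩ ⟨ha, hb⟩
      by_cases hab : a = b
      · subst hab
        obtain ⟨C, hC0, t, ht, hC⟩ := (hg a ha).exists_second_difference_le hS ha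
        refine ⟨t ×ˢ t, ?_, C, hC0, fun p hp _ _ => hC _ hp.1 _ hp.2⟩
        rw [nhdsWithin_prod_eq]
        exact prod_mem_prod ht ht
      · have hpos : 0 < ‖a - b‖ := norm_pos_iff.2 (sub_ne_zero.2 hab)
        have hB0 : 0 ≤ B := (norm_nonneg _).trans (hB a ha)
        refine ⟨{p | ‖a - b‖ / 2 < ‖p.1 - p.2‖}, mem_nhdsWithin_of_mem_nhds ?_,
          4 * B / (‖a - b‖ / 2) ^ 2, by positivity, ?_⟩
        · exact (isOpen_lt continuous_const (by fun_prop)).mem_nhds (half_lt_self hpos)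
        · rintro ⟨x, y⟩ hp hx hy
          have h1 := hB x hx
          have h2 := hB y hy
          have h3 := hB _ (hS.half_add_mem hx hy)
          calc _ ≤ ‖g x‖ + ‖g y‖ + ‖(2 : ℝ) • g ((2⁻¹ : ℝ) • (x + y))‖ :=
                (norm_sub_le _ _).trans (by gcongr; exact norm_add_le _ _)
            _ ≤ 4 * B := by
              rw [norm_smul, Real.norm_two]; dsimp only at h3; linarith
            _ = 4 * B / (‖a - b‖ / 2) ^ 2 * (‖a - b‖ / 2) ^ 2 := by field_simp
            _ ≤ _ := by
              gcongr
              exact le_of_lt hp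
  obtain ⟨C, hC0, hC⟩ := hsec
  refine ⟨max C (max K B), le_max_of_le_left hC0, fun x hx => ?_, fun x hx y hy => ?_,
    fun x hx y hy => ?_⟩
  · exact (hB x hx).trans (by simp)
  · have := hK.dist_le_mul x hx y hy
    rw [dist_eq_norm, dist_eq_norm] at this
    exact this.trans (by gcongr; simp)
  · exact (hC (x, y) ⟨hx, hy⟩ hx hy).trans (by gcongr; simp)

end C11

theorem abs_mul_second_difference_le {p q m p' q' m' A B d e e' : ℝ} (hd : 0 ≤ d) (hB : 0 ≤ B)
    (hA : 0 ≤ A)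
    (hp : |p| ≤ A) (hq : |q| ≤ A) (hpq : |p - q| ≤ A * d) (hs : |p + q - 2 * m| ≤ e)
    (hm' : |m'| ≤ B) (hpq' : |p' - q'| ≤ B * d) (hs' : |p' + q' - 2 * m'| ≤ e') :
    |p * p' + q * q' - 2 * (m * m')| ≤ A * e' + e * B + A * B * d ^ 2 := by
  have e1 : p * p' + q * q' - 2 * (m * m') = (p + q) / 2 * (p' + q' - 2 * m')
      + (p + q - 2 * m) * m' + (p - q) * (p' - q') / 2 := by ring
  have h1 : |(p + q) / 2| ≤ A := by
    rw [abs_le] at *; constructor <;> linarith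
  have h2 : |(p + q) / 2 * (p' + q' - 2 * m')| ≤ A * e' := by rw [abs_mul]; gcongr
  have h3 : |(p + q - 2 * m) * m'| ≤ e * B := by
    rw [abs_mul]; gcongr; exact (abs_nonneg _).trans hs
  have h4 : |(p - q) * (p' - q')| ≤ (A * d) * (B * d) := by rw [abs_mul]; gcongr
  have h5 : |(p - q) * (p' - q') / 2| ≤ A * B * d ^ 2 := by
    rw [abs_div, abs_two]
    have : 0 ≤ A * B * d ^ 2 := by positivity
    nlinarith
  rw [e1]
  exact (abs_add_three _ _ _).trans (by linarith)

theorem C11On.mul {E : Type*} [NormedAddCommGroup E] [NormedSpace ℝ E] {C D : ℝ} {S : Set E}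
    {f g : E → ℝ} (hS : Convex ℝ S) (hf : C11On C S f) (hg : C11On D S g) :
    C11On (3 * (C * D)) S (fun x => f x * g x) := by
  have hC := hf.nonneg
  have hD := hg.nonneg
  have hCD : 0 ≤ C * D := by positivity
  have hb : ∀ x ∈ S, ‖f x * g x‖ ≤ C * D := fun x hx => by
    rw [norm_mul]; gcongr; exacts [hf.bound x hx, hg.bound x hx]
  refine ⟨by positivity, fun x hx => (hb x hx).trans (by linarith), fun x hx y hy => ?_,
    fun x hx y hy => ?_⟩
  · have e : f x * g x - f y * g y = (f x - f y) * g x + f y * (g x - g y) := by ring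
    have h1 : ‖(f x - f y) * g x‖ ≤ (C * ‖x - y‖) * D := by
      rw [norm_mul]; gcongr; exacts [hf.lip x hx y hy, hg.bound x hx]
    have h2 : ‖f y * (g x - g y)‖ ≤ C * (D * ‖x - y‖) := by
      rw [norm_mul]; gcongr; exacts [hf.bound y hy, hg.lip x hx y hy]
    rw [e]
    refine (norm_add_le _ _).trans ?_
    nlinarith [mul_nonneg hCD (norm_nonneg (x - y))]
  · have := abs_mul_second_difference_le (norm_nonneg (x - y)) hD hC (hf.bound x hx) (hf.bound y hy)
      (hf.lip x hx y hy) (hf.second x hx y hy) (hg.bound _ (hS.half_add_mem hx hy))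
      (hg.lip x hx y hy) (hg.second x hx y hy)
    simp only [smul_eq_mul]
    exact this.trans (by linarith)

section Trapezium

theorem trapW_sum {N : ℕ} (hN : 1 ≤ N) (a : ℕ → ℝ) :
    ∑ j ∈ Finset.range (N + 1), (1 / N : ℝ) * trapW N j * a j
      = ∑ j ∈ Finset.range N, (1 / N : ℝ) * ((a j + a (j + 1)) / 2) := by
  have h : ∀ j ∈ Finset.range (N + 1), (1 / N : ℝ) * trapW N j * a j
      = (if j = N then 0 else (1 / N : ℝ) * (a j / 2))
        + (if j = 0 then 0 else (1 / N : ℝ) * (a j / 2)) := by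
    intro j _
    unfold trapW
    by_cases h0 : j = 0 <;> by_cases h1 : j = N
    · omega
    · simp [h0, show ¬ 0 = N by omega]; ring
    · simp [h1, show ¬ N = 0 by omega]; ring
    · simp [h0, h1]; ring
  rw [Finset.sum_congr rfl h, Finset.sum_add_distrib, Finset.sum_range_succ,
    Finset.sum_range_succ' (fun j => if j = 0 then 0 else (1 / N : ℝ) * (a j / 2))]
  simp only [if_true, add_zero, Nat.add_eq_zero_iff, one_ne_zero, and_false, if_false]
  rw [← Finset.sum_add_distrib]
  refine Finset.sum_congr rfl fun j hj => ?_
  rw [if_neg (Finset.mem_range.1 hj).ne]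
  ring

theorem trapW_nonneg (N j : ℕ) : 0 ≤ trapW N j := by
  unfold trapW; split_ifs <;> norm_num

theorem trapW_total {N : ℕ} (hN : 1 ≤ N) :
    ∑ j ∈ Finset.range (N + 1), (1 / N : ℝ) * trapW N j = 1 := by
  have h := trapW_sum hN fun _ => 1
  have hN' : (N : ℝ) ≠ 0 := by positivity
  simp only [mul_one] at h
  rw [h]
  simp [hN']

theorem node_mem_Icc {N j : ℕ} (hN : 1 ≤ N) (hj : j ≤ N) : (j : ℝ) / N ∈ Icc (0 : ℝ) 1 := by
  have : (0 : ℝ) < N := by exact_mod_cast hN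
  exact ⟨by positivity, (div_le_one this).2 (by exact_mod_cast hj)⟩

/-- Perturbing the nodal values by at most `ε` changes a weighted trapezium sum with weights
bounded by `C` by at most `C ε`. -/
theorem trapW_sum_sub_le {N : ℕ} (hN : 1 ≤ N) {k a b : ℕ → ℝ} {C ε : ℝ} (hC : 0 ≤ C)
    (hk : ∀ j ≤ N, |k j| ≤ C) (hab : ∀ j ≤ N, |a j - b j| ≤ ε) :
    |∑ j ∈ Finset.range (N + 1), (1 / N : ℝ) * trapW N j * k j * a j
      - ∑ j ∈ Finset.range (N + 1), (1 / N : ℝ) * trapW N j * (k j * b j)| ≤ C * ε := by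
  rw [← Finset.sum_sub_distrib]
  refine (Finset.abs_sum_le_sum_abs _ _).trans ?_
  have htot : C * ε = ∑ j ∈ Finset.range (N + 1), (1 / N : ℝ) * trapW N j * (C * ε) := by
    rw [← Finset.sum_mul, trapW_total hN, one_mul]
  rw [htot]
  refine Finset.sum_le_sum fun j hj => ?_
  have hj' : j ≤ N := by simpa [Nat.lt_succ_iff] using hj
  have hw : (0 : ℝ) ≤ 1 / N * trapW N j := mul_nonneg (by positivity) (trapW_nonneg N j)
  rw [show (1 / N : ℝ) * trapW N j * k j * a j - 1 / N * trapW N j * (k j * b j)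
    = 1 / N * trapW N j * (k j * (a j - b j)) by ring, abs_mul, abs_of_nonneg hw, abs_mul]
  gcongr
  exacts [hk j hj', hab j hj']

theorem trapezium_cell_error {g : ℝ → ℝ} {a b e : ℝ} (hab : a ≤ b)
    (hg : ContinuousOn g (Icc a b))
    (he : ∀ s ∈ Icc a b, |g s + g (a + b - s) - 2 * g ((a + b) / 2)| ≤ e) :
    |(b - a) * ((g a + g b) / 2) - ∫ s in a..b, g s| ≤ e * (b - a) := by
  have hi : IntervalIntegrable g MeasureTheory.volume a b := hg.intervalIntegrable_of_Icc hab
  have hg' : ContinuousOn (fun s => g (a + b - s)) (Icc a b) :=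
    hg.comp (by fun_prop) fun s hs => ⟨by linarith [hs.2], by linarith [hs.1]⟩
  have hi' := hg'.intervalIntegrable_of_Icc (μ := MeasureTheory.volume) hab
  have h1 : ∫ s in a..b, g (a + b - s) = ∫ s in a..b, g s := by
    rw [intervalIntegral.integral_comp_sub_left]; congr 1 <;> ring
  have h2 : (b - a) * ((g a + g b) / 2) - ∫ s in a..b, g s
      = ∫ s in a..b, ((g a + g b) / 2 - (g s + g (a + b - s)) / 2) := by
    rw [intervalIntegral.integral_sub intervalIntegrable_const ((hi.add hi').div_const 2),
      intervalIntegral.integral_const, intervalIntegral.integral_div,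
      intervalIntegral.integral_add hi hi', h1, smul_eq_mul]
    ring
  rw [h2, ← Real.norm_eq_abs]
  have h3 := intervalIntegral.norm_integral_le_of_norm_le_const (a := a) (b := b) (C := e)
    (f := fun s => (g a + g b) / 2 - (g s + g (a + b - s)) / 2) ?_
  · rwa [abs_of_nonneg (sub_nonneg.2 hab)] at h3
  · intro s hs
    rw [uIoc_of_le hab] at hs
    have e1 := he a (left_mem_Icc.2 hab)
    have e2 := he s (Ioc_subset_Icc_self hs)
    rw [show a + b - a = b by ring] at e1
    rw [Real.norm_eq_abs]
    rw [abs_le] at *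
    constructor <;> linarith

theorem trapezium_error {g : ℝ → ℝ} {N : ℕ} (hN : 1 ≤ N) (hg : ContinuousOn g (Icc 0 1))
    {e : ℕ → ℝ}
    (he : ∀ j < N, ∀ s ∈ Icc ((j : ℝ) / N) ((j + 1 : ℕ) / N : ℝ),
      ∀ t ∈ Icc ((j : ℝ) / N) ((j + 1 : ℕ) / N : ℝ), |g s + g t - 2 * g ((s + t) / 2)| ≤ e j) :
    |∑ j ∈ Finset.range (N + 1), (1 / N : ℝ) * trapW N j * g ((j : ℝ) / N) - ∫ s in (0 : ℝ)..1, g s|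
      ≤ ∑ j ∈ Finset.range N, e j * (1 / N) := by
  have hN' : (0 : ℝ) < N := by exact_mod_cast hN
  have hle : ∀ j : ℕ, (j : ℝ) / N ≤ (j + 1 : ℕ) / N := fun j => by gcongr; exact Nat.le_succ j
  have hd : ∀ j : ℕ, ((j + 1 : ℕ) : ℝ) / N - (j : ℝ) / N = 1 / N := fun j => by
    push_cast; ring
  have hsub : ∀ j < N, Icc ((j : ℝ) / N) ((j + 1 : ℕ) / N : ℝ) ⊆ Icc 0 1 := fun j hj =>
    Icc_subset_Icc (node_mem_Icc hN hj.le).1 (node_mem_Icc hN hj).2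
  have hsum := intervalIntegral.sum_integral_adjacent_intervals (f := g)
    (μ := MeasureTheory.volume) (a := fun j : ℕ => (j : ℝ) / N) (n := N)
    fun j hj => (hg.mono (hsub j hj)).intervalIntegrable_of_Icc (hle j)
  simp only [Nat.cast_zero, zero_div, div_self hN'.ne'] at hsum
  rw [trapW_sum hN fun j => g ((j : ℝ) / N), ← hsum, ← Finset.sum_sub_distrib]
  refine (Finset.abs_sum_le_sum_abs _ _).trans (Finset.sum_le_sum fun j hj => ?_)
  have hj' := Finset.mem_range.1 hj
  have := trapezium_cell_error (hle j) (hg.mono (hsub j hj')) (e := e j) fun s hs => by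
    have h := he j hj' s hs ((j : ℝ) / N + (j + 1 : ℕ) / N - s)
      ⟨by linarith [hs.2], by linarith [hs.1]⟩
    rwa [add_sub_cancel] at h
  rwa [hd j] at this

theorem C11On.trapezium_error {g : ℝ → ℝ} {C : ℝ} (hg : C11On C (Icc 0 1) g) {N : ℕ} (hN : 1 ≤ N) :
    |∑ j ∈ Finset.range (N + 1), (1 / N : ℝ) * trapW N j * g ((j : ℝ) / N) - ∫ s in (0 : ℝ)..1, g s|
      ≤ C * (1 / N) ^ 2 := by
  have hN' : (0 : ℝ) < N := by exact_mod_cast hN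
  refine (_root_.trapezium_error hN hg.continuousOn (e := fun _ => C * (1 / N : ℝ) ^ 2)
    fun j hj s hs t ht => ?_).trans ?_
  · have hsub : Icc ((j : ℝ) / N) ((j + 1 : ℕ) / N : ℝ) ⊆ Icc 0 1 :=
      Icc_subset_Icc (node_mem_Icc hN hj.le).1 (node_mem_Icc hN hj).2
    have h := hg.second s (hsub hs) t (hsub ht)
    simp only [smul_eq_mul, Real.norm_eq_abs] at h
    rw [inv_mul_eq_div] at h
    refine h.trans ?_
    have hC := hg.nonneg
    gcongr
    have := abs_sub_le_of_le_of_le hs.1 hs.2 ht.1 ht.2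
    refine this.trans (le_of_eq ?_)
    push_cast; ring
  · rw [Finset.sum_const, Finset.card_range, nsmul_eq_mul]
    apply le_of_eq; field_simp

end Trapezium

section Green

theorem greenG_of_le {x s : ℝ} (h : s ≤ x) :
    greenG x s = 1 / 6 * s * (x - 1) * (x ^ 2 - x + s ^ 2) := if_pos h

theorem greenG_of_ge {x s : ℝ} (h : x ≤ s) :
    greenG x s = 1 / 6 * x * (s - 1) * (s ^ 2 - s + x ^ 2) := by
  rcases h.eq_or_lt with rfl | h
  · rw [greenG_of_le le_rfl]
  · exact if_neg h.not_ge

theorem continuous_greenG : Continuous fun p : ℝ × ℝ => greenG p.1 p.2 := by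
  unfold greenG
  refine Continuous.if_le (by fun_prop) (by fun_prop) continuous_snd continuous_fst ?_
  intro p h
  rw [h]

theorem convex_unitSquare : Convex ℝ (Icc (0 : ℝ) 1 ×ˢ Icc (0 : ℝ) 1) :=
  (convex_Icc 0 1).prod (convex_Icc 0 1)

theorem isCompact_unitSquare : IsCompact (Icc (0 : ℝ) 1 ×ˢ Icc (0 : ℝ) 1) :=
  isCompact_Icc.prod isCompact_Icc

/-- `greenG` is bounded and Lipschitz on the unit square, with quadratic second differences
except across the diagonal. -/
theorem greenG_regularity : ∃ C : ℝ, 0 ≤ C ∧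
    (∀ p ∈ Icc (0 : ℝ) 1 ×ˢ Icc (0 : ℝ) 1, |greenG p.1 p.2| ≤ C) ∧
    (∀ p ∈ Icc (0 : ℝ) 1 ×ˢ Icc (0 : ℝ) 1, ∀ q ∈ Icc (0 : ℝ) 1 ×ˢ Icc (0 : ℝ) 1,
      |greenG p.1 p.2 - greenG q.1 q.2| ≤ C * ‖p - q‖) ∧
    (∀ p ∈ Icc (0 : ℝ) 1 ×ˢ Icc (0 : ℝ) 1, ∀ q ∈ Icc (0 : ℝ) 1 ×ˢ Icc (0 : ℝ) 1,
      |greenG p.1 p.2 + greenG q.1 q.2 - 2 * greenG ((p.1 + q.1) / 2) ((p.2 + q.2) / 2)| ≤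
        C * ‖p - q‖ ^ 2 + if (p.2 - p.1) * (q.2 - q.1) < 0 then C * ‖p - q‖ else 0) := by
  set S := Icc (0 : ℝ) 1 ×ˢ Icc (0 : ℝ) 1
  obtain ⟨C₁, hA⟩ := ContDiffOn.exists_c11On convex_unitSquare isCompact_unitSquare
    (g := fun p : ℝ × ℝ => 1 / 6 * p.2 * (p.1 - 1) * (p.1 ^ 2 - p.1 + p.2 ^ 2))
    (ContDiff.contDiffOn (by fun_prop))
  obtain ⟨C₂, hB⟩ := ContDiffOn.exists_c11On convex_unitSquare isCompact_unitSquare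
    (g := fun p : ℝ × ℝ => 1 / 6 * p.1 * (p.2 - 1) * (p.2 ^ 2 - p.2 + p.1 ^ 2))
    (ContDiff.contDiffOn (by fun_prop))
  replace hA := hA.mono_const (le_max_left C₁ C₂)
  replace hB := hB.mono_const (le_max_right C₁ C₂)
  set C := max C₁ C₂
  have hC : 0 ≤ C := hA.nonneg
  have lower : ∀ p ∈ S, ∀ q ∈ S, p.2 ≤ p.1 → q.2 ≤ q.1 →
      |greenG p.1 p.2 - greenG q.1 q.2| ≤ C * ‖p - q‖ := fun p hp q hq h1 h2 => by
    rw [greenG_of_le h1, greenG_of_le h2]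
    exact hA.lip p hp q hq
  have upper : ∀ p ∈ S, ∀ q ∈ S, p.1 ≤ p.2 → q.1 ≤ q.2 →
      |greenG p.1 p.2 - greenG q.1 q.2| ≤ C * ‖p - q‖ := fun p hp q hq h1 h2 => by
    rw [greenG_of_ge h1, greenG_of_ge h2]
    exact hB.lip p hp q hq
  have cross : ∀ p ∈ S, ∀ q ∈ S, p.2 < p.1 → q.1 < q.2 →
      |greenG p.1 p.2 - greenG q.1 q.2| ≤ C * ‖p - q‖ := fun p hp q hq h1 h2 => by
    set α := (p.1 - p.2) / (p.1 - p.2 + (q.2 - q.1)) with hα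
    have hpos : 0 < p.1 - p.2 + (q.2 - q.1) := by linarith
    have hα0 : 0 ≤ α := div_nonneg (by linarith) hpos.le
    have hα1 : α ≤ 1 := (div_le_one hpos).2 (by linarith)
    set r := (1 - α) • p + α • q with hr
    have hrS : r ∈ S := convex_unitSquare hp hq (by linarith) hα0 (by ring)
    have hdiag : r.1 = r.2 := by
      simp only [hr, hα, Prod.fst_add, Prod.snd_add, Prod.smul_fst, Prod.smul_snd, smul_eq_mul]
      field_simp
      ring
    have l := lower p hp r hrS h1.le hdiag.ge
    have u := upper r hrS q hq hdiag.le h2.le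
    have e1 : p - r = α • (p - q) := by rw [hr]; module
    have e2 : r - q = (1 - α) • (p - q) := by rw [hr]; module
    rw [e1, norm_smul, Real.norm_of_nonneg hα0] at l
    rw [e2, norm_smul, Real.norm_of_nonneg (by linarith : (0 : ℝ) ≤ 1 - α)] at u
    refine (abs_sub_le _ (greenG r.1 r.2) _).trans ((add_le_add l u).trans (le_of_eq ?_))
    ring
  have lip : ∀ p ∈ S, ∀ q ∈ S, |greenG p.1 p.2 - greenG q.1 q.2| ≤ C * ‖p - q‖ := by
    intro p hp q hq
    rcases lt_or_ge p.2 p.1 with h1 | h1 <;> rcases lt_or_ge q.2 q.1 with h2 | h2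
    · exact lower p hp q hq h1.le h2.le
    · rcases h2.eq_or_lt with h2 | h2
      · exact lower p hp q hq h1.le h2.ge
      · exact cross p hp q hq h1 h2
    · rcases h1.eq_or_lt with h1 | h1
      · exact lower p hp q hq h1.ge h2.le
      · rw [abs_sub_comm, norm_sub_rev]
        exact cross q hq p hp h2 h1
    · exact upper p hp q hq h1 h2
  refine ⟨C, hC, fun p hp => ?_, lip, fun p hp q hq => ?_⟩
  · rcases le_total p.2 p.1 with h | h
    · rw [greenG_of_le h]; exact hA.bound p hp
    · rw [greenG_of_ge h]; exact hB.bound p hp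
  · have hm : ((p.1 + q.1) / 2, (p.2 + q.2) / 2) = (2⁻¹ : ℝ) • (p + q) := by
      ext <;> simp <;> ring
    split_ifs with h
    · have hmS := convex_unitSquare.half_add_mem hp hq
      have h1 := lip p hp _ hmS
      have h2 := lip q hq _ hmS
      rw [show p - (2⁻¹ : ℝ) • (p + q) = (2⁻¹ : ℝ) • (p - q) by module, norm_smul, ← hm] at h1
      rw [show q - (2⁻¹ : ℝ) • (p + q) = (2⁻¹ : ℝ) • (q - p) by module, norm_smul, norm_sub_rev q p,
        ← hm] at h2
      norm_num at h1 h2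
      have h3 : 0 ≤ C * ‖p - q‖ ^ 2 := by positivity
      rw [abs_le] at *
      constructor <;> linarith
    · rw [add_zero]
      have hsame : (p.2 ≤ p.1 ∧ q.2 ≤ q.1) ∨ (p.1 ≤ p.2 ∧ q.1 ≤ q.2) := by
        by_contra! hcon
        apply h
        rcases lt_or_ge p.1 p.2 with h1 | h1
        · have := hcon.2 h1.le
          exact mul_neg_of_pos_of_neg (by linarith) (by linarith)
        · have h2 := hcon.1 h1
          have h3 : p.2 < p.1 := by
            by_contra! h4
            linarith [hcon.2 h4]
          exact mul_neg_of_neg_of_pos (by linarith) (by linarith)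
      rcases hsame with ⟨h1, h2⟩ | ⟨h1, h2⟩
      · have := hA.second p hp q hq
        rw [← hm] at this
        rw [greenG_of_le h1, greenG_of_le h2, greenG_of_le (by linarith)]
        exact this
      · have := hB.second p hp q hq
        rw [← hm] at this
        rw [greenG_of_ge h1, greenG_of_ge h2, greenG_of_ge (by linarith)]
        exact this

end Green

section GreenOperator

theorem continuous_greenG_right (x : ℝ) : Continuous fun t => greenG x t :=
  continuous_greenG.comp (by fun_prop : Continuous fun t : ℝ => (x, t))

theorem abs_integral_unit_le {F : ℝ → ℝ} {c : ℝ} (h : ∀ t ∈ Icc (0 : ℝ) 1, |F t| ≤ c) :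
    |∫ t in (0 : ℝ)..1, F t| ≤ c := by
  have := intervalIntegral.norm_integral_le_of_norm_le_const (a := 0) (b := 1) (f := F) (C := c)
    fun t ht => h t (by rw [uIoc_of_le zero_le_one] at ht; exact Ioc_subset_Icc_self ht)
  simpa using this

theorem second_difference_integral {a b c w : ℝ → ℝ} (ha : ContinuousOn a (Icc 0 1))
    (hb : ContinuousOn b (Icc 0 1)) (hc : ContinuousOn c (Icc 0 1))
    (hw : ContinuousOn w (Icc 0 1)) :
    (∫ t in (0 : ℝ)..1, a t * w t) + (∫ t in (0 : ℝ)..1, b t * w t)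
        - 2 * (∫ t in (0 : ℝ)..1, c t * w t)
      = ∫ t in (0 : ℝ)..1, (a t + b t - 2 * c t) * w t := by
  have i (f : ℝ → ℝ) (hf : ContinuousOn f (Icc 0 1)) :
      IntervalIntegrable (fun t => f t * w t) MeasureTheory.volume 0 1 :=
    (hf.mul hw).intervalIntegrable_of_Icc zero_le_one
  rw [← intervalIntegral.integral_add (i a ha) (i b hb), ← intervalIntegral.integral_const_mul,
    ← intervalIntegral.integral_sub ((i a ha).add (i b hb)) ((i c hc).const_mul 2)]
  congr 1 with t
  ring

theorem difference_integral {a b w : ℝ → ℝ} (ha : ContinuousOn a (Icc 0 1))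
    (hb : ContinuousOn b (Icc 0 1)) (hw : ContinuousOn w (Icc 0 1)) :
    (∫ t in (0 : ℝ)..1, a t * w t) - (∫ t in (0 : ℝ)..1, b t * w t)
      = ∫ t in (0 : ℝ)..1, (a t - b t) * w t := by
  have i (f : ℝ → ℝ) (hf : ContinuousOn f (Icc 0 1)) :
      IntervalIntegrable (fun t => f t * w t) MeasureTheory.volume 0 1 :=
    (hf.mul hw).intervalIntegrable_of_Icc zero_le_one
  rw [← intervalIntegral.integral_sub (i a ha) (i b hb)]
  congr 1 with t
  ring

theorem integral_indicator_between_le (x y : ℝ) :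
    IntervalIntegrable (indicator {t : ℝ | (t - x) * (t - y) < 0} fun _ => (1 : ℝ))
      MeasureTheory.volume 0 1 ∧
    ∫ t in (0 : ℝ)..1, indicator {t : ℝ | (t - x) * (t - y) < 0} (fun _ => (1 : ℝ)) t
      ≤ |x - y| := by
  have hT : {t : ℝ | (t - x) * (t - y) < 0} = Ioo (min x y) (max x y) := by
    ext t
    simp only [mem_ofPred_eq, mul_neg_iff, mem_Ioo, min_lt_iff, lt_max_iff, sub_pos, sub_neg]
    grind
  rw [hT]
  constructor
  · rw [intervalIntegrable_iff, uIoc_of_le zero_le_one]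
    exact (MeasureTheory.integrableOn_const (by simp)).indicator measurableSet_Ioo
  · rw [intervalIntegral.integral_of_le zero_le_one,
      MeasureTheory.setIntegral_indicator measurableSet_Ioo, MeasureTheory.setIntegral_const,
      smul_eq_mul, mul_one]
    refine (MeasureTheory.measureReal_mono inter_subset_right (by simp)).trans ?_
    rw [Real.volume_real_Ioo_of_le min_le_max, max_sub_min_eq_abs, abs_sub_comm]

theorem norm_sub_prodMk_right (x y t : ℝ) : ‖((x, t) : ℝ × ℝ) - (y, t)‖ = |x - y| := by
  simp [Prod.norm_def]

theorem norm_sub_prodMk_left (x s t : ℝ) : ‖((x, s) : ℝ × ℝ) - (x, t)‖ = |s - t| := by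
  simp [Prod.norm_def]

theorem solOp_c11On {ψ : ℝ → ℝ} {D : ℝ} (hD : 0 ≤ D) (hψ : ContinuousOn ψ (Icc 0 1))
    (hb : ∀ t ∈ Icc (0 : ℝ) 1, |ψ t| ≤ D) : ∃ C, C11On C (Icc 0 1) (solOp ψ) := by
  obtain ⟨C, hC, hbd, hlip, hsec⟩ := greenG_regularity
  have hc (x : ℝ) : ContinuousOn (fun t => greenG x t) (Icc 0 1) :=
    (continuous_greenG_right x).continuousOn
  have hCD : 0 ≤ C * D := by positivity
  refine ⟨2 * (C * D), by positivity, fun x hx => ?_, fun x hx y hy => ?_, fun x hx y hy => ?_⟩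
  · refine (abs_integral_unit_le (c := C * D) fun t ht => ?_).trans (by linarith)
    rw [abs_mul]; gcongr; exacts [hbd (x, t) ⟨hx, ht⟩, hb t ht]
  · unfold solOp
    rw [difference_integral (hc x) (hc y) hψ]
    refine (abs_integral_unit_le (c := C * ‖x - y‖ * D) fun t ht => ?_).trans ?_
    · rw [abs_mul]
      gcongr
      · have := hlip (x, t) ⟨hx, ht⟩ (y, t) ⟨hy, ht⟩
        rwa [norm_sub_prodMk_right] at this
      · exact hb t ht
    · nlinarith [mul_nonneg hCD (norm_nonneg (x - y))]
  · have hxy : (2⁻¹ : ℝ) • (x + y) = (x + y) / 2 := by rw [smul_eq_mul]; ring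
    rw [hxy]
    unfold solOp
    rw [smul_eq_mul, second_difference_integral (hc x) (hc y) (hc _) hψ]
    obtain ⟨hi, hle⟩ := integral_indicator_between_le x y
    have hi' : IntervalIntegrable (fun t => C * D * |x - y| ^ 2 + C * D * |x - y| *
        indicator {t : ℝ | (t - x) * (t - y) < 0} (fun _ => (1 : ℝ)) t)
        MeasureTheory.volume 0 1 := intervalIntegrable_const.add (hi.const_mul _)
    refine (intervalIntegral.norm_integral_le_of_norm_le zero_le_one (.of_forall fun t ht => ?_)
      hi').trans ?_
    · have ht' := Ioc_subset_Icc_self ht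
      have h := hsec (x, t) ⟨hx, ht'⟩ (y, t) ⟨hy, ht'⟩
      rw [norm_sub_prodMk_right] at h
      dsimp only at h
      rw [show (t + t) / 2 = t by ring] at h
      rw [norm_mul, Real.norm_eq_abs, Real.norm_eq_abs]
      refine (mul_le_mul h (hb t ht') (abs_nonneg _) ((abs_nonneg _).trans h)).trans (le_of_eq ?_)
      simp only [indicator_apply, mem_ofPred_eq]
      split_ifs <;> ring
    · rw [intervalIntegral.integral_add intervalIntegrable_const (hi.const_mul _),
        intervalIntegral.integral_const, intervalIntegral.integral_const_mul]
      have := mul_le_mul_of_nonneg_left hle (mul_nonneg hCD (abs_nonneg (x - y)))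
      simp only [sub_zero, one_smul, Real.norm_eq_abs]
      linarith

theorem greenG_trapezium_error {ψ : ℝ → ℝ} {D : ℝ} (hψ : C11On D (Icc 0 1) ψ) :
    ∃ C, ∀ N : ℕ, 1 ≤ N → ∀ x ∈ Icc (0 : ℝ) 1,
      |∑ j ∈ Finset.range (N + 1), (1 / N : ℝ) * trapW N j *
          (greenG x ((j : ℝ) / N) * ψ ((j : ℝ) / N)) - solOp ψ x| ≤ C * (1 / N) ^ 2 := by
  obtain ⟨C, hC, hbd, hlip, hsec⟩ := greenG_regularity
  have hD := hψ.nonneg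
  have hCD : 0 ≤ C * D := by positivity
  refine ⟨4 * (C * D), fun N hN x hx => ?_⟩
  have hN' : (0 : ℝ) < N := by exact_mod_cast hN
  let P : ℕ → Prop := fun j => (j : ℝ) / N < x ∧ x < (j + 1 : ℕ) / N
  classical
  refine (trapezium_error hN (g := fun t => greenG x t * ψ t)
    ((continuous_greenG_right x).continuousOn.mul hψ.continuousOn)
    (e := fun j => 3 * (C * D) * (1 / N) ^ 2 + if P j then C * D * (1 / N) else 0)
    fun j hj s hs t ht => ?_).trans ?_
  · have hsub : Icc ((j : ℝ) / N) ((j + 1 : ℕ) / N : ℝ) ⊆ Icc 0 1 :=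
      Icc_subset_Icc (node_mem_Icc hN hj.le).1 (node_mem_Icc hN hj).2
    have hst : |s - t| ≤ 1 / N := by
      refine (abs_sub_le_of_le_of_le hs.1 hs.2 ht.1 ht.2).trans (le_of_eq ?_)
      push_cast; ring
    have hs' := hsub hs
    have ht' := hsub ht
    have hmid := (convex_Icc (0 : ℝ) 1).half_add_mem hs' ht'
    have h1 := hsec (x, s) ⟨hx, hs'⟩ (x, t) ⟨hx, ht'⟩
    have h2 := hlip (x, s) ⟨hx, hs'⟩ (x, t) ⟨hx, ht'⟩
    have h3 := hψ.second s hs' t ht'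
    have h4 := hψ.bound _ hmid
    rw [norm_sub_prodMk_left] at h1 h2
    simp only [smul_eq_mul, Real.norm_eq_abs, inv_mul_eq_div] at h3 h4
    dsimp only at h1
    rw [show (x + x) / 2 = x by ring] at h1
    have h5 : (if (s - x) * (t - x) < 0 then C * |s - t| else 0)
        ≤ if P j then C * (1 / N) else 0 := by
      by_cases hP : P j
      · rw [if_pos hP]
        split_ifs
        · gcongr
        · positivity
      · rw [if_neg hP, if_neg]
        rw [not_lt]
        simp only [P, not_and_or, not_lt] at hP
        rcases hP with hP | hP
        · exact mul_nonneg (by linarith [hs.1]) (by linarith [ht.1])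
        · exact mul_nonneg_of_nonpos_of_nonpos (by linarith [hs.2]) (by linarith [ht.2])
    have h6 := abs_mul_second_difference_le (abs_nonneg (s - t)) hD hC (hbd (x, s) ⟨hx, hs'⟩)
      (hbd (x, t) ⟨hx, ht'⟩) h2 h1 h4 (hψ.lip s hs' t ht') h3
    have h7 : |s - t| ^ 2 ≤ (1 / N : ℝ) ^ 2 := by gcongr
    have h8 := mul_le_mul_of_nonneg_left h7 hCD
    have h9 := mul_le_mul_of_nonneg_right h5 hD
    have h10 : (if P j then C * (1 / N : ℝ) else 0) * D = if P j then C * D * (1 / N) else 0 := by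
      split_ifs <;> ring
    rw [h10] at h9
    refine h6.trans ?_
    linarith
  · have hone : ((Finset.range N).filter P).card ≤ 1 := by
      rw [Finset.card_le_one]
      intro i hi j hj
      simp only [Finset.mem_filter, P, div_lt_iff₀ hN', lt_div_iff₀ hN'] at hi hj
      have h1 : (i : ℝ) < (j + 1 : ℕ) := hi.2.1.trans hj.2.2
      have h2 : (j : ℝ) < (i + 1 : ℕ) := hj.2.1.trans hi.2.2
      norm_cast at h1 h2
      omega
    rw [← Finset.sum_mul, Finset.sum_add_distrib, Finset.sum_const, Finset.card_range,
      ← Finset.sum_filter, Finset.sum_const, nsmul_eq_mul, nsmul_eq_mul]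
    have h1 : (((Finset.range N).filter P).card : ℝ) * (C * D * (1 / N)) ≤ 1 * (C * D * (1 / N)) := by
      gcongr
      exact_mod_cast hone
    have h2 := mul_le_mul_of_nonneg_right h1 (by positivity : (0 : ℝ) ≤ 1 / N)
    have h3 : (N : ℝ) * (3 * (C * D) * (1 / N) ^ 2) * (1 / N) = 3 * (C * D) * (1 / N) ^ 2 := by
      field_simp
    rw [add_mul, h3]
    linarith

theorem greenG_sign_change {x : ℝ} (hx : x ∈ Ioo (0 : ℝ) 1) :
    ∃ a r b : ℝ, 0 ≤ a ∧ a < r ∧ r < b ∧ b ≤ 1 ∧ (∀ s ∈ Ioo a r, 0 < greenG x s) ∧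
      ∀ s ∈ Ioo r b, greenG x s < 0 := by
  obtain ⟨hx0, hx1⟩ := hx
  rcases lt_trichotomy x (1 / 2) with h | h | h
  · have hpos : 0 < 1 - 4 * x ^ 2 := by nlinarith
    set q := √(1 - 4 * x ^ 2) with hq
    have hq0 : 0 < q := Real.sqrt_pos.2 hpos
    have hq2 : q ^ 2 = 1 - 4 * x ^ 2 := Real.sq_sqrt hpos.le
    have hq1 : q < 1 := by nlinarith
    have e (s : ℝ) : s ^ 2 - s + x ^ 2 = (s - (1 + q) / 2) * (s - (1 - q) / 2) := by
      linear_combination (1 / 4) * hq2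
    refine ⟨1 / 2, (1 + q) / 2, 1, by norm_num, by linarith, by linarith, le_rfl,
      fun s hs => ?_, fun s hs => ?_⟩
    · rw [greenG_of_ge (by linarith [hs.1]), e]
      exact mul_pos_of_neg_of_neg (mul_neg_of_pos_of_neg (by positivity) (by linarith [hs.2]))
        (mul_neg_of_neg_of_pos (by linarith [hs.2]) (by linarith [hs.1]))
    · rw [greenG_of_ge (by linarith [hs.1]), e]
      exact mul_neg_of_neg_of_pos (mul_neg_of_pos_of_neg (by positivity) (by linarith [hs.2]))
        (mul_pos (by linarith [hs.1]) (by linarith [hs.1]))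
  · subst h
    refine ⟨0, 1 / 2, 1, le_rfl, by norm_num, by norm_num, le_rfl, fun s hs => ?_, fun s hs => ?_⟩
    · rw [greenG_of_le hs.2.le]
      have := hs.1
      exact mul_pos_of_neg_of_neg (mul_neg_of_pos_of_neg (by positivity) (by norm_num))
        (by nlinarith [hs.1, hs.2])
    · rw [greenG_of_ge hs.1.le]
      exact mul_neg_of_neg_of_pos (mul_neg_of_pos_of_neg (by positivity) (by linarith [hs.2]))
        (by nlinarith [hs.1, hs.2])
  · have hpos : 0 < x - x ^ 2 := by nlinarith
    set r := √(x - x ^ 2) with hr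
    have hr0 : 0 < r := Real.sqrt_pos.2 hpos
    have hr2 : r ^ 2 = x - x ^ 2 := Real.sq_sqrt hpos.le
    have hrx : r < x := by nlinarith
    refine ⟨0, r, x, le_rfl, hr0, hrx, hx1.le, fun s hs => ?_, fun s hs => ?_⟩
    · rw [greenG_of_le (by linarith [hs.2])]
      have := hs.1
      exact mul_pos_of_neg_of_neg (mul_neg_of_pos_of_neg (by positivity) (by linarith))
        (by nlinarith [hs.1, hs.2])
    · rw [greenG_of_le hs.2.le]
      have : 0 < s := hr0.trans hs.1
      exact mul_neg_of_neg_of_pos (mul_neg_of_pos_of_neg (by positivity) (by linarith))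
        (by nlinarith [hs.1, hs.2])

theorem solOp_lt {ψ : ℝ → ℝ} {M x : ℝ} (hM : 0 < M) (hψ : ContinuousOn ψ (Icc 0 1))
    (hb : ∀ t ∈ Icc (0 : ℝ) 1, |ψ t| ≤ M) (hx : x ∈ Ioo (0 : ℝ) 1) :
    solOp ψ x < (∫ s in (0 : ℝ)..1, |greenG x s|) * M := by
  have hG := (continuous_greenG_right x).continuousOn (s := Icc 0 1)
  have hle : ∀ t ∈ Icc (0 : ℝ) 1, greenG x t * ψ t ≤ |greenG x t| * M := fun t ht =>
    (le_abs_self _).trans (by rw [abs_mul]; gcongr; exact hb t ht)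
  rw [← intervalIntegral.integral_mul_const]
  refine intervalIntegral.integral_lt_integral_of_continuousOn_of_le_of_exists_lt zero_lt_one
    (hG.mul hψ) (hG.abs.mul continuousOn_const) (fun t ht => hle t (Ioc_subset_Icc_self ht)) ?_
  by_contra! hcon
  obtain ⟨a, r, b, ha, har, hrb, hb1, hpos, hneg⟩ := greenG_sign_change hx
  have h1 : EqOn ψ (fun _ => M) (Icc a r) := by
    refine EqOn.of_subset_closure (s := Ioo a r) (fun s hs => ?_)
      (hψ.mono (Icc_subset_Icc ha (hrb.le.trans hb1))) continuousOn_const Ioo_subset_Icc_self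
      (closure_Ioo har.ne).ge
    have hsI : s ∈ Icc (0 : ℝ) 1 := ⟨ha.trans hs.1.le, hs.2.le.trans (hrb.le.trans hb1)⟩
    have h := hcon s hsI
    rw [abs_of_pos (hpos s hs)] at h
    exact le_antisymm (abs_le.1 (hb s hsI)).2 (le_of_mul_le_mul_left h (hpos s hs))
  have h2 : EqOn ψ (fun _ => -M) (Icc r b) := by
    refine EqOn.of_subset_closure (s := Ioo r b) (fun s hs => ?_)
      (hψ.mono (Icc_subset_Icc (ha.trans har.le) hb1)) continuousOn_const Ioo_subset_Icc_self
      (closure_Ioo hrb.ne).ge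
    have hsI : s ∈ Icc (0 : ℝ) 1 := ⟨(ha.trans har.le).trans hs.1.le, hs.2.le.trans hb1⟩
    have h := hcon s hsI
    rw [abs_of_neg (hneg s hs)] at h
    exact le_antisymm (by nlinarith [hneg s hs]) (abs_le.1 (hb s hsI)).1
  have := h1 (right_mem_Icc.2 har.le)
  have := h2 (left_mem_Icc.2 hrb.le)
  dsimp only at *
  linarith

theorem integral_abs_greenG_pos {x : ℝ} (hx : x ∈ Ioo (0 : ℝ) 1) :
    0 < ∫ s in (0 : ℝ)..1, |greenG x s| := by
  have h := solOp_lt (ψ := fun _ => 0) one_pos continuousOn_const (by simp) hx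
  simpa [solOp] using h

/-- Since `greenG x` changes sign, a continuous `ψ` bounded by `M` never attains the bound
`M₀ M` for `solOp ψ`. -/
theorem exists_abs_solOp_le_sub {ψ : ℝ → ℝ} {M M₀ : ℝ} (hM : 0 < M)
    (hM₀ : ∀ x ∈ Icc (0 : ℝ) 1, ∫ s in (0 : ℝ)..1, |greenG x s| ≤ M₀)
    (hψ : ContinuousOn ψ (Icc 0 1)) (hb : ∀ t ∈ Icc (0 : ℝ) 1, |ψ t| ≤ M) :
    ∃ δ > 0, ∀ x ∈ Icc (0 : ℝ) 1, |solOp ψ x| ≤ M₀ * M - δ := by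
  have hlt : ∀ x ∈ Icc (0 : ℝ) 1, |solOp ψ x| < M₀ * M := by
    intro x hx
    by_cases hx' : x ∈ Ioo (0 : ℝ) 1
    · have h1 := solOp_lt hM hψ hb hx'
      have h2 := solOp_lt (ψ := fun t => -ψ t) hM hψ.neg (by simpa using hb) hx'
      have h3 : solOp (fun t => -ψ t) x = -solOp ψ x := by
        simp [solOp]
      rw [h3] at h2
      refine (abs_lt.2 ⟨by linarith, h1⟩).trans_le ?_
      gcongr
      exact hM₀ x hx
    · have hzero : solOp ψ x = 0 := by
        have : ∀ t ∈ uIcc (0 : ℝ) 1, greenG x t * ψ t = 0 := by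
          intro t ht
          rw [uIcc_of_le zero_le_one] at ht
          have h01 : x = 0 ∨ x = 1 := by
            by_contra! hne
            exact hx' ⟨lt_of_le_of_ne hx.1 hne.1.symm, lt_of_le_of_ne hx.2 hne.2⟩
          rcases h01 with rfl | rfl
          · rw [greenG_of_ge ht.1]; ring
          · rw [greenG_of_le ht.2]; ring
        unfold solOp
        rw [intervalIntegral.integral_congr (g := fun _ => 0) this]
        simp
      rw [hzero, abs_zero]
      refine mul_pos ?_ hM
      exact (integral_abs_greenG_pos (x := 1 / 2) (by norm_num)).trans_le (hM₀ _ (by norm_num))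
  obtain ⟨C, hC⟩ := solOp_c11On hM.le hψ hb
  obtain ⟨z, hz, hmax⟩ := isCompact_Icc.exists_isMaxOn (nonempty_Icc.2 zero_le_one)
    hC.continuousOn.abs
  refine ⟨M₀ * M - |solOp ψ z|, sub_pos.2 (hlt z hz), fun x hx => ?_⟩
  rw [sub_sub_cancel]
  exact hmax hx

end GreenOperator

section Kernel

theorem C11On.kernel_right {k : ℝ → ℝ → ℝ} {C : ℝ}
    (hk : C11On C (Icc 0 1 ×ˢ Icc 0 1) fun p : ℝ × ℝ => k p.1 p.2) {x : ℝ}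
    (hx : x ∈ Icc (0 : ℝ) 1) : C11On C (Icc 0 1) (k x) := by
  refine ⟨hk.nonneg, fun t ht => hk.bound (x, t) ⟨hx, ht⟩, fun s hs t ht => ?_,
    fun s hs t ht => ?_⟩
  · have := hk.lip (x, s) ⟨hx, hs⟩ (x, t) ⟨hx, ht⟩
    rwa [norm_sub_prodMk_left] at this
  · have := hk.second (x, s) ⟨hx, hs⟩ (x, t) ⟨hx, ht⟩
    have e : (2⁻¹ : ℝ) • ((x, s) + (x, t)) = (x, (2⁻¹ : ℝ) • (s + t)) := by
      ext <;> simp; ring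
    rw [norm_sub_prodMk_left, e] at this
    exact this

theorem integral_kernel_c11On {k : ℝ → ℝ → ℝ} {C D : ℝ}
    (hk : C11On C (Icc 0 1 ×ˢ Icc 0 1) fun p : ℝ × ℝ => k p.1 p.2) {w : ℝ → ℝ} (hD : 0 ≤ D)
    (hw : ContinuousOn w (Icc 0 1)) (hb : ∀ t ∈ Icc (0 : ℝ) 1, |w t| ≤ D) :
    C11On (C * D) (Icc 0 1) fun x => ∫ t in (0 : ℝ)..1, k x t * w t := by
  have hC := hk.nonneg
  have hc (x : ℝ) (hx : x ∈ Icc (0 : ℝ) 1) : ContinuousOn (k x) (Icc 0 1) :=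
    (hk.kernel_right hx).continuousOn
  refine ⟨by positivity, fun x hx => abs_integral_unit_le fun t ht => ?_, fun x hx y hy => ?_,
    fun x hx y hy => ?_⟩
  · rw [abs_mul]; gcongr; exacts [hk.bound (x, t) ⟨hx, ht⟩, hb t ht]
  · rw [difference_integral (hc x hx) (hc y hy) hw, mul_right_comm]
    refine abs_integral_unit_le fun t ht => ?_
    have := hk.lip (x, t) ⟨hx, ht⟩ (y, t) ⟨hy, ht⟩
    rw [norm_sub_prodMk_right] at this
    rw [abs_mul]; gcongr; exacts [this, hb t ht]
  · rw [smul_eq_mul, second_difference_integral (hc x hx) (hc y hy)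
      (hc _ ((convex_Icc 0 1).half_add_mem hx hy)) hw, mul_right_comm]
    refine abs_integral_unit_le fun t ht => ?_
    have := hk.second (x, t) ⟨hx, ht⟩ (y, t) ⟨hy, ht⟩
    rw [norm_sub_prodMk_right, show (2⁻¹ : ℝ) • ((x, t) + (y, t)) = ((2⁻¹ : ℝ) • (x + y), t) by
      ext <;> simp; ring] at this
    rw [abs_mul]; gcongr; exacts [this, hb t ht]

theorem abs_integral_kernel_le {k w : ℝ → ℝ} {K B : ℝ} (hB : 0 ≤ B)
    (hk : ContinuousOn k (Icc 0 1)) (hK : ∫ s in (0 : ℝ)..1, |k s| ≤ K)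
    (hb : ∀ t ∈ Icc (0 : ℝ) 1, |w t| ≤ B) : |∫ t in (0 : ℝ)..1, k t * w t| ≤ K * B := by
  have hi : IntervalIntegrable (fun t => |k t| * B) MeasureTheory.volume 0 1 :=
    (hk.abs.mul continuousOn_const).intervalIntegrable_of_Icc zero_le_one
  rw [← Real.norm_eq_abs]
  refine (intervalIntegral.norm_integral_le_of_norm_le zero_le_one (.of_forall fun t ht => ?_)
    hi).trans ?_
  · rw [norm_mul, Real.norm_eq_abs, Real.norm_eq_abs]
    gcongr
    exact hb t (Ioc_subset_Icc_self ht)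
  · rw [intervalIntegral.integral_mul_const]
    gcongr

theorem eq_zero_of_integral_abs_nonpos {k : ℝ → ℝ} (hk : ContinuousOn k (Icc 0 1))
    (h : ∫ s in (0 : ℝ)..1, |k s| ≤ 0) : ∀ t ∈ Icc (0 : ℝ) 1, k t = 0 := by
  intro t ht
  by_contra hne
  have := intervalIntegral.integral_lt_integral_of_continuousOn_of_le_of_exists_lt
    (f := fun _ => (0 : ℝ)) zero_lt_one continuousOn_const hk.abs (fun _ _ => abs_nonneg _)
    ⟨t, ht, abs_pos.2 hne⟩
  simp only [intervalIntegral.integral_zero] at this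
  linarith

theorem exists_forall_mul_inv_sq_le (C : ℝ) {η : ℝ} (hη : 0 < η) :
    ∃ N₀ : ℕ, ∀ N : ℕ, N₀ ≤ N → C * (1 / N : ℝ) ^ 2 ≤ η := by
  have h : Tendsto (fun N : ℕ => C * (1 / N : ℝ) ^ 2) atTop (𝓝 0) := by
    simpa using (tendsto_one_div_atTop_nhds_zero_nat.pow 2).const_mul C
  exact eventually_atTop.1 (h.eventually_le_const hη)

theorem exists_error_bound_of_eventually {e : ℕ → ℕ → ℝ} {C : ℝ} {N₀ : ℕ}
    (h : ∀ N, N₀ ≤ N → 1 ≤ N → ∀ i ≤ N, |e N i| ≤ C * (1 / N : ℝ) ^ 2) :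
    ∃ C', ∀ N, 1 ≤ N → ∀ i ≤ N, |e N i| ≤ C' * (1 / N : ℝ) ^ 2 := by
  set R := ∑ N ∈ Finset.range N₀, ∑ i ∈ Finset.range (N + 1), |e N i| * (N : ℝ) ^ 2 with hR
  have hR0 : 0 ≤ R := by positivity
  refine ⟨|C| + R, fun N hN i hi => ?_⟩
  rcases le_or_gt N₀ N with hN' | hN'
  · refine (h N hN' hN i hi).trans ?_
    gcongr
    linarith [le_abs_self C]
  · have hpos : (0 : ℝ) < N := by exact_mod_cast hN
    have h1 : |e N i| * (N : ℝ) ^ 2 ≤ ∑ i ∈ Finset.range (N + 1), |e N i| * (N : ℝ) ^ 2 :=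
      Finset.single_le_sum (f := fun i => |e N i| * (N : ℝ) ^ 2) (fun _ _ => by positivity)
        (Finset.mem_range.2 (Nat.lt_succ_of_le hi))
    have h2 : ∑ i ∈ Finset.range (N + 1), |e N i| * (N : ℝ) ^ 2 ≤ R :=
      Finset.single_le_sum
        (f := fun N : ℕ => ∑ i ∈ Finset.range (N + 1), |e N i| * (N : ℝ) ^ 2)
        (fun _ _ => by positivity) (Finset.mem_range.2 hN')
    calc |e N i| = |e N i| * (N : ℝ) ^ 2 * (1 / N : ℝ) ^ 2 := by field_simp
      _ ≤ (|C| + R) * (1 / N : ℝ) ^ 2 := by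
        gcongr
        linarith [abs_nonneg C]

theorem Kdisc_error {k : ℝ → ℝ → ℝ} {C D : ℝ}
    (hk : C11On C (Icc 0 1 ×ˢ Icc 0 1) fun p : ℝ × ℝ => k p.1 p.2) {w : ℝ → ℝ}
    (hw : C11On D (Icc 0 1) w) {W : ℕ → ℕ → ℝ} {c : ℝ}
    (hW : ∀ N, 1 ≤ N → ∀ i ≤ N, |W N i - w ((i : ℝ) / N)| ≤ c * (1 / N : ℝ) ^ 2) :
    ∃ C', ∀ N, 1 ≤ N → ∀ i ≤ N,
      |Kdisc k N (W N) i - ∫ t in (0 : ℝ)..1, k ((i : ℝ) / N) t * w t| ≤ C' * (1 / N : ℝ) ^ 2 := by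
  refine ⟨C * c + 3 * (C * D), fun N hN i hi => ?_⟩
  have hx := node_mem_Icc hN hi
  have h1 := trapW_sum_sub_le hN (k := fun j => k ((i : ℝ) / N) ((j : ℝ) / N)) (a := W N)
    (b := fun j => w ((j : ℝ) / N)) hk.nonneg
    (fun j hj => hk.bound (_, _) ⟨hx, node_mem_Icc hN hj⟩) (hW N hN)
  have h2 := ((hk.kernel_right hx).mul (convex_Icc 0 1) hw).trapezium_error hN
  refine (abs_sub_le _ _ _).trans ((add_le_add h1 h2).trans (le_of_eq ?_))
  ring

theorem greenG_sum_error {ψ : ℝ → ℝ} {D : ℝ} (hψ : C11On D (Icc 0 1) ψ) {Ψ : ℕ → ℕ → ℝ} {c : ℝ}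
    (hΨ : ∀ N, 1 ≤ N → ∀ i ≤ N, |Ψ N i - ψ ((i : ℝ) / N)| ≤ c * (1 / N : ℝ) ^ 2) :
    ∃ C, ∀ N : ℕ, 1 ≤ N → ∀ x ∈ Icc (0 : ℝ) 1,
      |∑ j ∈ Finset.range (N + 1), (1 / N : ℝ) * trapW N j * greenG x ((j : ℝ) / N) * Ψ N j
        - solOp ψ x| ≤ C * (1 / N : ℝ) ^ 2 := by
  obtain ⟨C, hC, hbd, -⟩ := greenG_regularity
  obtain ⟨C', hC'⟩ := greenG_trapezium_error hψ
  refine ⟨C * c + C', fun N hN x hx => ?_⟩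
  have h1 := trapW_sum_sub_le hN (k := fun j => greenG x ((j : ℝ) / N)) (a := Ψ N)
    (b := fun j => ψ ((j : ℝ) / N)) hC (fun j hj => hbd (_, _) ⟨hx, node_mem_Icc hN hj⟩) (hΨ N hN)
  refine (abs_sub_le _ _ _).trans ((add_le_add h1 (hC' N hN x hx)).trans (le_of_eq ?_))
  ring

theorem exists_abs_le_of_error {w : ℝ → ℝ} {θ : ℝ → ℝ} {W : ℕ → ℕ → ℝ} {c B δ : ℝ} (hδ : 0 < δ)
    (hθ : MapsTo θ (Icc 0 1) (Icc 0 1)) (hw : ∀ x ∈ Icc (0 : ℝ) 1, |w x| ≤ B - δ)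
    (hW : ∀ N, 1 ≤ N → ∀ i ≤ N, |W N i - w (θ ((i : ℝ) / N))| ≤ c * (1 / N : ℝ) ^ 2) :
    ∃ N₀ : ℕ, ∀ N, N₀ ≤ N → 1 ≤ N → ∀ i ≤ N, |W N i| ≤ B := by
  obtain ⟨N₀, hN₀⟩ := exists_forall_mul_inv_sq_le c hδ
  refine ⟨N₀, fun N hN hN1 i hi => ?_⟩
  have h1 := (hW N hN1 i hi).trans (hN₀ N hN)
  have h2 := hw _ (hθ (node_mem_Icc hN1 hi))
  have h3 := abs_sub_abs_le_abs_sub (W N i) (w (θ ((i : ℝ) / N)))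
  linarith

theorem exists_abs_Kdisc_le {k : ℝ → ℝ → ℝ} {C K : ℝ}
    (hk : C11On C (Icc 0 1 ×ˢ Icc 0 1) fun p : ℝ × ℝ => k p.1 p.2) (hK0 : 0 ≤ K)
    (hK : ∀ x ∈ Icc (0 : ℝ) 1, ∫ s in (0 : ℝ)..1, |k x s| ≤ K) {w : ℝ → ℝ} {W : ℕ → ℕ → ℝ}
    {c B δ : ℝ} (hδ : 0 < δ) (hw : ∀ x ∈ Icc (0 : ℝ) 1, |w x| ≤ B - δ)
    (hW : ∀ N, 1 ≤ N → ∀ i ≤ N,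
      |Kdisc k N (W N) i - ∫ t in (0 : ℝ)..1, k ((i : ℝ) / N) t * w t| ≤ c * (1 / N : ℝ) ^ 2) :
    ∃ N₀ : ℕ, ∀ N, N₀ ≤ N → 1 ≤ N → ∀ i ≤ N, |Kdisc k N (W N) i| ≤ K * B := by
  have hB : 0 ≤ B - δ := (abs_nonneg _).trans (hw 0 (by simp))
  rcases hK0.eq_or_lt with hK' | hK'
  · refine ⟨0, fun N _ hN i hi => ?_⟩
    have hx := node_mem_Icc hN hi
    have hz := eq_zero_of_integral_abs_nonpos (hk.kernel_right hx).continuousOn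
      ((hK _ hx).trans hK'.ge)
    have : Kdisc k N (W N) i = 0 := Finset.sum_eq_zero fun j hj => by
      rw [hz _ (node_mem_Icc hN (Nat.lt_succ_iff.1 (Finset.mem_range.1 hj)))]
      ring
    simp [this, ← hK']
  · exact exists_abs_le_of_error (w := fun x => ∫ t in (0 : ℝ)..1, k x t * w t) (θ := id)
      (mul_pos hK' hδ) (mapsTo_id _) (fun x hx => by
        rw [← mul_sub]
        exact abs_integral_kernel_le hB (hk.kernel_right hx).continuousOn (hK x hx) hw) hW

end Kernel

section Iterates

theorem DM_eq_prod (M₀ K₀ K₁ M : ℝ) : DM M₀ K₀ K₁ M =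
    Icc 0 1 ×ˢ Icc (-(M₀ * M)) (M₀ * M) ×ˢ Icc (-(M₀ * M)) (M₀ * M) ×ˢ
      Icc (-(M₀ * K₀ * M)) (M₀ * K₀ * M) ×ˢ Icc (-(M₀ * K₁ * M)) (M₀ * K₁ * M) := by
  ext p
  simp only [DM, mem_ofPred_eq, mem_prod, mem_Icc, abs_le]

theorem convex_DM (M₀ K₀ K₁ M : ℝ) : Convex ℝ (DM M₀ K₀ K₁ M) := by
  rw [DM_eq_prod]
  exact (convex_Icc _ _).prod ((convex_Icc _ _).prod ((convex_Icc _ _).prod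
    ((convex_Icc _ _).prod (convex_Icc _ _))))

theorem isCompact_DM (M₀ K₀ K₁ M : ℝ) : IsCompact (DM M₀ K₀ K₁ M) := by
  rw [DM_eq_prod]
  exact isCompact_Icc.prod (isCompact_Icc.prod (isCompact_Icc.prod
    (isCompact_Icc.prod isCompact_Icc)))

variable {k₀ k₁ : ℝ → ℝ → ℝ} {φ : ℝ → ℝ} {M M₀ K₀ K₁ C₀ C₁ Cφ Cf : ℝ}
  {f : ℝ → ℝ → ℝ → ℝ → ℝ → ℝ}

theorem psiSeq_regularity
    (hk₀ : C11On C₀ (Icc 0 1 ×ˢ Icc 0 1) fun p : ℝ × ℝ => k₀ p.1 p.2)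
    (hk₁ : C11On C₁ (Icc 0 1 ×ˢ Icc 0 1) fun p : ℝ × ℝ => k₁ p.1 p.2)
    (hφ : C11On Cφ (Icc 0 1) φ) (hφmap : MapsTo φ (Icc (0 : ℝ) 1) (Icc (0 : ℝ) 1))
    (hM : 0 < M)
    (hM₀ : ∀ x ∈ Icc (0 : ℝ) 1, ∫ s in (0 : ℝ)..1, |greenG x s| ≤ M₀)
    (hK₀ : ∀ x ∈ Icc (0 : ℝ) 1, ∫ s in (0 : ℝ)..1, |k₀ x s| ≤ K₀)
    (hK₁ : ∀ x ∈ Icc (0 : ℝ) 1, ∫ s in (0 : ℝ)..1, |k₁ x s| ≤ K₁)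
    (hf : C11On Cf (DM M₀ K₀ K₁ M)
      fun p : ℝ × ℝ × ℝ × ℝ × ℝ => f p.1 p.2.1 p.2.2.1 p.2.2.2.1 p.2.2.2.2)
    (hfb : ∀ x u y v z : ℝ, (x, u, y, v, z) ∈ DM M₀ K₀ K₁ M → |f x u y v z| ≤ M) (m : ℕ) :
    (∃ C, C11On C (Icc 0 1) (psiSeq f k₀ k₁ φ m)) ∧
      (∀ x ∈ Icc (0 : ℝ) 1, |psiSeq f k₀ k₁ φ m x| ≤ M) ∧
      ∀ x ∈ Icc (0 : ℝ) 1, (x, solOp (psiSeq f k₀ k₁ φ m) x, solOp (psiSeq f k₀ k₁ φ m) (φ x),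
        ∫ t in (0 : ℝ)..1, k₀ x t * solOp (psiSeq f k₀ k₁ φ m) t,
        ∫ t in (0 : ℝ)..1, k₁ x t * solOp (psiSeq f k₀ k₁ φ m) (φ t)) ∈ DM M₀ K₀ K₁ M := by
  have nonneg {k : ℝ → ℝ → ℝ} {K : ℝ}
      (h : ∀ x ∈ Icc (0 : ℝ) 1, ∫ s in (0 : ℝ)..1, |k x s| ≤ K) : 0 ≤ K :=
    (intervalIntegral.integral_nonneg zero_le_one fun _ _ => abs_nonneg _).trans (h 0 (by simp))
  have hM₀0 := nonneg hM₀
  have hK₀0 := nonneg hK₀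
  have hK₁0 := nonneg hK₁
  have hMM : 0 ≤ M₀ * M := by positivity
  have hI : Convex ℝ (Icc (0 : ℝ) 1) := convex_Icc 0 1
  obtain ⟨Ci, hid⟩ := ContDiffOn.exists_c11On hI isCompact_Icc (contDiffOn_id (𝕜 := ℝ))
  have args {ψ : ℝ → ℝ} {C : ℝ} (hψ : C11On C (Icc 0 1) ψ)
      (hb : ∀ x ∈ Icc (0 : ℝ) 1, |ψ x| ≤ M) :
      (∃ C, C11On C (Icc 0 1) fun x => (x, solOp ψ x, solOp ψ (φ x),
        ∫ t in (0 : ℝ)..1, k₀ x t * solOp ψ t, ∫ t in (0 : ℝ)..1, k₁ x t * solOp ψ (φ t))) ∧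
      ∀ x ∈ Icc (0 : ℝ) 1, (x, solOp ψ x, solOp ψ (φ x),
        ∫ t in (0 : ℝ)..1, k₀ x t * solOp ψ t,
        ∫ t in (0 : ℝ)..1, k₁ x t * solOp ψ (φ t)) ∈ DM M₀ K₀ K₁ M := by
    obtain ⟨Cu, hu⟩ := solOp_c11On hM.le hψ.continuousOn hb
    have hub : ∀ x ∈ Icc (0 : ℝ) 1, |solOp ψ x| ≤ M₀ * M := fun x hx =>
      abs_integral_kernel_le hM.le (continuous_greenG_right x).continuousOn (hM₀ x hx) hb
    have hy := hu.comp hφ hI hI hφmap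
    have hyb : ∀ x ∈ Icc (0 : ℝ) 1, |solOp ψ (φ x)| ≤ M₀ * M := fun x hx => hub _ (hφmap hx)
    have hv := integral_kernel_c11On hk₀ hMM hu.continuousOn hub
    have hz := integral_kernel_c11On hk₁ hMM hy.continuousOn hyb
    refine ⟨⟨_, hid.prodMk (hu.prodMk (hy.prodMk (hv.prodMk hz)))⟩,
      fun x hx => ⟨hx, hub x hx, hyb x hx, ?_, ?_⟩⟩
    · rw [mul_comm M₀, mul_assoc]
      exact abs_integral_kernel_le hMM (hk₀.kernel_right hx).continuousOn (hK₀ x hx) hub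
    · rw [mul_comm M₀, mul_assoc]
      exact abs_integral_kernel_le hMM (hk₁.kernel_right hx).continuousOn (hK₁ x hx) hyb
  have main : (∃ C, C11On C (Icc 0 1) (psiSeq f k₀ k₁ φ m)) ∧
      ∀ x ∈ Icc (0 : ℝ) 1, |psiSeq f k₀ k₁ φ m x| ≤ M := by
    induction m with
    | zero =>
      have hmem : MapsTo (fun x : ℝ => (x, (0 : ℝ), (0 : ℝ), (0 : ℝ), (0 : ℝ))) (Icc 0 1)
          (DM M₀ K₀ K₁ M) := fun x hx => by
        refine ⟨hx, ?_, ?_, ?_, ?_⟩ <;> simp only [abs_zero] <;> positivity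
      exact ⟨⟨_, hf.comp (hid.prodMk (C11On.const _ 0)) hI (convex_DM _ _ _ _) hmem⟩,
        fun x hx => hfb _ _ _ _ _ (hmem hx)⟩
    | succ m ih =>
      obtain ⟨⟨C, hψ⟩, hb⟩ := ih
      obtain ⟨⟨C', hγ⟩, hmem⟩ := args hψ hb
      exact ⟨⟨_, hf.comp hγ hI (convex_DM _ _ _ _) hmem⟩, fun x hx => hfb _ _ _ _ _ (hmem x hx)⟩
  obtain ⟨⟨C, hψ⟩, hb⟩ := main
  exact ⟨⟨C, hψ⟩, hb, (args hψ hb).2⟩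

end Iterates
end

/-- Proposition 3, Second-order accuracy of the discrete iterates: under the
smoothness assumptions and conditions (i)-(iii), for every `m` there is a constant `C_m`
independent of `N` such that the discrete iterates differ from the continuous ones by at
most `C_m h²` at all grid nodes. -/
theorem discrete_iterates_second_order (k₀ k₁ : ℝ → ℝ → ℝ)
    (hk₀ : ContDiffOn ℝ 2 (fun p : ℝ × ℝ => k₀ p.1 p.2) (Set.Icc 0 1 ×ˢ Set.Icc 0 1))
    (hk₁ : ContDiffOn ℝ 2 (fun p : ℝ × ℝ => k₁ p.1 p.2) (Set.Icc 0 1 ×ˢ Set.Icc 0 1))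
    (φ : ℝ → ℝ) (hφ : ContDiffOn ℝ 2 φ (Set.Icc 0 1))
    (hφmap : Set.MapsTo φ (Set.Icc (0 : ℝ) 1) (Set.Icc (0 : ℝ) 1))
    (M M₀ K₀ K₁ L₀ L₁ L₂ L₃ : ℝ) (hM : 0 < M)
    (hL₀ : 0 ≤ L₀) (hL₁ : 0 ≤ L₁) (hL₂ : 0 ≤ L₂) (hL₃ : 0 ≤ L₃)
    (hM₀ : IsGreatest {y : ℝ | ∃ x ∈ Set.Icc (0 : ℝ) 1, y = ∫ s in (0 : ℝ)..1, |greenG x s|} M₀)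
    (hK₀ : IsGreatest {y : ℝ | ∃ x ∈ Set.Icc (0 : ℝ) 1, y = ∫ s in (0 : ℝ)..1, |k₀ x s|} K₀)
    (hK₁ : IsGreatest {y : ℝ | ∃ x ∈ Set.Icc (0 : ℝ) 1, y = ∫ s in (0 : ℝ)..1, |k₁ x s|} K₁)
    (f : ℝ → ℝ → ℝ → ℝ → ℝ → ℝ)
    (hf : ContDiffOn ℝ 2 (fun p : ℝ × ℝ × ℝ × ℝ × ℝ => f p.1 p.2.1 p.2.2.1 p.2.2.2.1 p.2.2.2.2)
      (DM M₀ K₀ K₁ M))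
    (hfb : ∀ x u y v z : ℝ, (x, u, y, v, z) ∈ DM M₀ K₀ K₁ M → |f x u y v z| ≤ M)
    (hfL : ∀ x u₁ y₁ v₁ z₁ u₂ y₂ v₂ z₂ : ℝ,
      (x, u₁, y₁, v₁, z₁) ∈ DM M₀ K₀ K₁ M → (x, u₂, y₂, v₂, z₂) ∈ DM M₀ K₀ K₁ M →
      |f x u₂ y₂ v₂ z₂ - f x u₁ y₁ v₁ z₁| ≤
        L₀ * |u₂ - u₁| + L₁ * |y₂ - y₁| + L₂ * |v₂ - v₁| + L₃ * |z₂ - z₁|)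
    (hq : (L₀ + L₁ + L₂ * K₀ + L₃ * K₁) * M₀ < 1) :
    ∀ m : ℕ, ∃ C : ℝ, ∀ N : ℕ, 1 ≤ N → ∀ i : ℕ, i ≤ N →
      |PsiSeq f k₀ k₁ φ N m i - psiSeq f k₀ k₁ φ m ((i : ℝ) / N)| ≤ C * ((1 : ℝ) / N) ^ 2 ∧
      |Udisc N (PsiSeq f k₀ k₁ φ N m) i - solOp (psiSeq f k₀ k₁ φ m) ((i : ℝ) / N)|
        ≤ C * ((1 : ℝ) / N) ^ 2 ∧
      |Ydisc φ N (PsiSeq f k₀ k₁ φ N m) i - solOp (psiSeq f k₀ k₁ φ m) (φ ((i : ℝ) / N))|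
        ≤ C * ((1 : ℝ) / N) ^ 2 ∧
      |Kdisc k₀ N (Udisc N (PsiSeq f k₀ k₁ φ N m)) i -
          ∫ t in (0 : ℝ)..1, k₀ ((i : ℝ) / N) t * solOp (psiSeq f k₀ k₁ φ m) t|
        ≤ C * ((1 : ℝ) / N) ^ 2 ∧
      |Kdisc k₁ N (Ydisc φ N (PsiSeq f k₀ k₁ φ N m)) i -
          ∫ t in (0 : ℝ)..1, k₁ ((i : ℝ) / N) t * solOp (psiSeq f k₀ k₁ φ m) (φ t)|
        ≤ C * ((1 : ℝ) / N) ^ 2 := by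
  have hSq := convex_unitSquare
  have hcI : IsCompact (Set.Icc (0 : ℝ) 1) := isCompact_Icc
  obtain ⟨C₀, hk₀'⟩ := hk₀.exists_c11On hSq isCompact_unitSquare
  obtain ⟨C₁, hk₁'⟩ := hk₁.exists_c11On hSq isCompact_unitSquare
  obtain ⟨Cφ, hφ'⟩ := hφ.exists_c11On (convex_Icc 0 1) hcI
  obtain ⟨Cf, hf'⟩ := hf.exists_c11On (convex_DM _ _ _ _) (isCompact_DM _ _ _ _)
  have hM₀' : ∀ x ∈ Set.Icc (0 : ℝ) 1, ∫ s in (0 : ℝ)..1, |greenG x s| ≤ M₀ :=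
    fun x hx => hM₀.2 ⟨x, hx, rfl⟩
  have hK₀' : ∀ x ∈ Set.Icc (0 : ℝ) 1, ∫ s in (0 : ℝ)..1, |k₀ x s| ≤ K₀ :=
    fun x hx => hK₀.2 ⟨x, hx, rfl⟩
  have hK₁' : ∀ x ∈ Set.Icc (0 : ℝ) 1, ∫ s in (0 : ℝ)..1, |k₁ x s| ≤ K₁ :=
    fun x hx => hK₁.2 ⟨x, hx, rfl⟩
  have hK₀0 : 0 ≤ K₀ := (intervalIntegral.integral_nonneg zero_le_one fun _ _ =>
    abs_nonneg _).trans (hK₀' 0 (by simp))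
  have hK₁0 : 0 ≤ K₁ := (intervalIntegral.integral_nonneg zero_le_one fun _ _ =>
    abs_nonneg _).trans (hK₁' 0 (by simp))
  have hreg := psiSeq_regularity hk₀' hk₁' hφ' hφmap hM hM₀' hK₀' hK₁' hf' hfb
  have hdisc : ∀ m : ℕ, (∃ c : ℝ, ∀ N : ℕ, 1 ≤ N → ∀ i : ℕ, i ≤ N →
      |PsiSeq f k₀ k₁ φ N m i - psiSeq f k₀ k₁ φ m ((i : ℝ) / N)| ≤ c * ((1 : ℝ) / N) ^ 2) →
      ∃ cu cv cz : ℝ, ∀ N : ℕ, 1 ≤ N → ∀ i : ℕ, i ≤ N →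
      |Udisc N (PsiSeq f k₀ k₁ φ N m) i - solOp (psiSeq f k₀ k₁ φ m) ((i : ℝ) / N)|
        ≤ cu * ((1 : ℝ) / N) ^ 2 ∧
      |Ydisc φ N (PsiSeq f k₀ k₁ φ N m) i - solOp (psiSeq f k₀ k₁ φ m) (φ ((i : ℝ) / N))|
        ≤ cu * ((1 : ℝ) / N) ^ 2 ∧
      |Kdisc k₀ N (Udisc N (PsiSeq f k₀ k₁ φ N m)) i -
          ∫ t in (0 : ℝ)..1, k₀ ((i : ℝ) / N) t * solOp (psiSeq f k₀ k₁ φ m) t|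
        ≤ cv * ((1 : ℝ) / N) ^ 2 ∧
      |Kdisc k₁ N (Ydisc φ N (PsiSeq f k₀ k₁ φ N m)) i -
          ∫ t in (0 : ℝ)..1, k₁ ((i : ℝ) / N) t * solOp (psiSeq f k₀ k₁ φ m) (φ t)|
        ≤ cz * ((1 : ℝ) / N) ^ 2 := by
    rintro m ⟨c, hc⟩
    obtain ⟨⟨C, hψ⟩, hb, -⟩ := hreg m
    obtain ⟨Cu, hu⟩ := solOp_c11On hM.le hψ.continuousOn hb
    have hy := hu.comp hφ' (convex_Icc 0 1) (convex_Icc 0 1) hφmap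
    obtain ⟨cu, hcu⟩ := greenG_sum_error hψ (Ψ := fun N => PsiSeq f k₀ k₁ φ N m) hc
    have hU : ∀ N : ℕ, 1 ≤ N → ∀ i ≤ N,
        |Udisc N (PsiSeq f k₀ k₁ φ N m) i - solOp (psiSeq f k₀ k₁ φ m) ((i : ℝ) / N)|
        ≤ cu * ((1 : ℝ) / N) ^ 2 := fun N hN i hi => hcu N hN _ (node_mem_Icc hN hi)
    have hY : ∀ N : ℕ, 1 ≤ N → ∀ i ≤ N,
        |Ydisc φ N (PsiSeq f k₀ k₁ φ N m) i - solOp (psiSeq f k₀ k₁ φ m) (φ ((i : ℝ) / N))|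
        ≤ cu * ((1 : ℝ) / N) ^ 2 := fun N hN i hi => hcu N hN _ (hφmap (node_mem_Icc hN hi))
    obtain ⟨cv, hV⟩ := Kdisc_error hk₀' hu (W := fun N => Udisc N (PsiSeq f k₀ k₁ φ N m)) hU
    obtain ⟨cz, hZ⟩ := Kdisc_error hk₁' hy (W := fun N => Ydisc φ N (PsiSeq f k₀ k₁ φ N m)) hY
    exact ⟨cu, cv, cz, fun N hN i hi => ⟨hU N hN i hi, hY N hN i hi, hV N hN i hi, hZ N hN i hi⟩⟩
  have hmain : ∀ m : ℕ, ∃ c : ℝ, ∀ N : ℕ, 1 ≤ N → ∀ i : ℕ, i ≤ N →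
      |PsiSeq f k₀ k₁ φ N m i - psiSeq f k₀ k₁ φ m ((i : ℝ) / N)| ≤ c * ((1 : ℝ) / N) ^ 2 := by
    intro m
    induction m with
    | zero => exact ⟨0, fun N _ i _ => by simp [PsiSeq, psiSeq]⟩
    | succ m ih =>
      obtain ⟨cu, cv, cz, hc⟩ := hdisc m ih
      obtain ⟨⟨C, hψ⟩, hb, hmem⟩ := hreg m
      obtain ⟨δ, hδ, hu⟩ := exists_abs_solOp_le_sub hM hM₀' hψ.continuousOn hb
      have hy : ∀ x ∈ Set.Icc (0 : ℝ) 1, |solOp (psiSeq f k₀ k₁ φ m) (φ x)| ≤ M₀ * M - δ :=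
        fun x hx => hu _ (hφmap hx)
      obtain ⟨N₁, h₁⟩ := exists_abs_le_of_error (θ := id)
        (W := fun N => Udisc N (PsiSeq f k₀ k₁ φ N m)) hδ (Set.mapsTo_id _) hu
        fun N hN i hi => (hc N hN i hi).1
      obtain ⟨N₂, h₂⟩ := exists_abs_le_of_error
        (W := fun N => Ydisc φ N (PsiSeq f k₀ k₁ φ N m)) hδ hφmap hu
        fun N hN i hi => (hc N hN i hi).2.1
      obtain ⟨N₃, h₃⟩ := exists_abs_Kdisc_le hk₀' hK₀0 hK₀'
        (W := fun N => Udisc N (PsiSeq f k₀ k₁ φ N m)) hδ hu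
        fun N hN i hi => (hc N hN i hi).2.2.1
      obtain ⟨N₄, h₄⟩ := exists_abs_Kdisc_le hk₁' hK₁0 hK₁'
        (W := fun N => Ydisc φ N (PsiSeq f k₀ k₁ φ N m)) hδ hy
        fun N hN i hi => (hc N hN i hi).2.2.2
      refine exists_error_bound_of_eventually (N₀ := max (max N₁ N₂) (max N₃ N₄))
        (C := L₀ * cu + L₁ * cu + L₂ * cv + L₃ * cz) fun N hN hN1 i hi => ?_
      simp only [max_le_iff] at hN
      obtain ⟨⟨hN₁, hN₂⟩, hN₃, hN₄⟩ := hN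
      obtain ⟨eu, ey, ev, ez⟩ := hc N hN1 i hi
      have hx := node_mem_Icc hN1 hi
      have e0 := mul_le_mul_of_nonneg_left eu hL₀
      have e1 := mul_le_mul_of_nonneg_left ey hL₁
      have e2 := mul_le_mul_of_nonneg_left ev hL₂
      have e3 := mul_le_mul_of_nonneg_left ez hL₃
      have e := hfL _ _ _ _ _ _ _ _ _ (hmem _ hx) (show ((i : ℝ) / N,
        Udisc N (PsiSeq f k₀ k₁ φ N m) i, Ydisc φ N (PsiSeq f k₀ k₁ φ N m) i,
        Kdisc k₀ N (Udisc N (PsiSeq f k₀ k₁ φ N m)) i,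
        Kdisc k₁ N (Ydisc φ N (PsiSeq f k₀ k₁ φ N m)) i) ∈ DM M₀ K₀ K₁ M from
        ⟨hx, h₁ N hN₁ hN1 i hi, h₂ N hN₂ hN1 i hi,
          (h₃ N hN₃ hN1 i hi).trans_eq (by ring), (h₄ N hN₄ hN1 i hi).trans_eq (by ring)⟩)
      refine le_trans e ?_
      linarith
  intro m
  obtain ⟨c, hc⟩ := hmain m
  obtain ⟨cu, cv, cz, h⟩ := hdisc m ⟨c, hc⟩
  refine ⟨max (max c cu) (max cv cz), fun N hN i hi => ?_⟩
  obtain ⟨eu, ey, ev, ez⟩ := h N hN i hi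
  refine ⟨(hc N hN i hi).trans ?_, eu.trans ?_, ey.trans ?_, ev.trans ?_, ez.trans ?_⟩ <;>
    gcongr <;> simp
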